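/- arXiv:1910.06509 — 8 statements merged into one kernel-verified Lean document; each statement's English description precedes it below -/
import Mathlib

section
/- For the cycle graph C_n on n ≥ 3 vertices, the Shapley influence value of every vertex equals 2/3 − 1/n. -/
open Finset

/-- Number of connected components of the subgraph of `G` induced on the finite
vertex set `C` (this is `0` when `C = ∅`). -/
noncomputable def betti {V : Type*} (G : SimpleGraph V) (C : Finset V) : ℕ :=
  Nat.card ((SimpleGraph.induce (↑C : Set V) G).ConnectedComponent)

/-- The Shapley influence value
`s(v) = Σ_{C ⊆ V∖{v}} (|C|!·(n−|C|−1)!/n!)·|β(C∪{v}) − β(C)|`. -/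
noncomputable def shapley {V : Type*} [Fintype V] [DecidableEq V]
    (G : SimpleGraph V) (v : V) : ℝ :=
  ∑ C ∈ (Finset.univ.erase v).powerset,
    ((C.card.factorial : ℝ) * ((Fintype.card V - C.card - 1).factorial : ℝ)
        / ((Fintype.card V).factorial : ℝ)) *
      |((betti G (insert v C) : ℝ)) - ((betti G C : ℝ))|

/-- Normalized influence score `μ(v) = s(v) / Σ_u s(u)`. -/
noncomputable def influence {V : Type*} [Fintype V] [DecidableEq V]
    (G : SimpleGraph V) (v : V) : ℝ :=
  shapley G v / ∑ u : V, shapley G u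

/-- Entropy `H(G) = −Σ_v μ(v)·log μ(v)`. -/
noncomputable def graphEntropy {V : Type*} [Fintype V] [DecidableEq V]
    (G : SimpleGraph V) : ℝ :=
  -∑ v : V, influence G v * Real.log (influence G v)

/-- The cycle graph on `Fin n`: `i` adjacent to `j` iff they differ by `1` mod `n`. -/
def cycleGraph (n : ℕ) : SimpleGraph (Fin n) :=
  SimpleGraph.fromRel (fun i j => (i.val + 1) % n = j.val)

namespace CycleShapley

open scoped Fin.CommRing

variable {m : ℕ}

theorem cycleGraph_adj_iff (i j : Fin (m + 3)) :
    (cycleGraph (m + 3)).Adj i j ↔ j = i + 1 ∨ i = j + 1 := by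
  have key (i j : Fin (m + 3)) : (i.val + 1) % (m + 3) = j.val ↔ j = i + 1 := by
    rw [Fin.ext_iff, Fin.val_add, Fin.val_one]
    exact eq_comm
  have hne (k : Fin (m + 3)) : k ≠ k + 1 := by simp
  simp only [cycleGraph, SimpleGraph.fromRel_adj, key]
  constructor
  · exact fun h => h.2
  · rintro (rfl | rfl)
    · exact ⟨hne i, Or.inl rfl⟩
    · exact ⟨(hne j).symm, Or.inr rfl⟩

/-- A run of consecutive vertices of `C` lies in a single component. -/
theorem reachable_add (C : Finset (Fin (m + 3))) (k : ℕ) (x : Fin (m + 3))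
    (h : ∀ j ≤ k, x + (j : Fin (m + 3)) ∈ C) (hx : x ∈ C) (hk : x + (k : Fin (m + 3)) ∈ C) :
    (SimpleGraph.induce (↑C : Set (Fin (m + 3))) (cycleGraph (m + 3))).Reachable
      ⟨x, hx⟩ ⟨x + (k : Fin (m + 3)), hk⟩ := by
  induction k with
  | zero => simp
  | succ k ih =>
    refine (ih (fun j hj => h j (by omega)) (h k (by omega))).trans
      (SimpleGraph.Adj.reachable ?_)
    rw [SimpleGraph.comap_adj]
    refine (cycleGraph_adj_iff _ _).2 (Or.inl ?_)
    simp [add_assoc]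

/-- The vertices of `C` whose successor is not in `C`. -/
def rightEnds (C : Finset (Fin (m + 3))) : Finset (Fin (m + 3)) :=
  C.filter fun i => i + 1 ∉ C

theorem betti_univ : betti (cycleGraph (m + 3)) univ = 1 := by
  rw [betti, Nat.card_eq_one_iff_unique]
  refine ⟨⟨fun c d => ?_⟩, ⟨SimpleGraph.connectedComponentMk _ ⟨0, by simp⟩⟩⟩
  induction c using SimpleGraph.ConnectedComponent.ind with | _ x
  induction d using SimpleGraph.ConnectedComponent.ind with | _ y
  rw [SimpleGraph.ConnectedComponent.eq]
  have h := reachable_add univ (y.1 - x.1).val x.1 (by simp) (by simp) (by simp)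
  simpa using h

theorem exists_add_notMem {C : Finset (Fin (m + 3))} (hC : C ≠ univ) (x : Fin (m + 3)) :
    ∃ k : ℕ, x + (k : Fin (m + 3)) + 1 ∉ C := by
  obtain ⟨w, hw⟩ : ∃ w, w ∉ C := by
    by_contra! h
    exact hC (eq_univ_iff_forall.2 h)
  refine ⟨(w - x - 1).val, ?_⟩
  rw [Fin.cast_val_eq_self]
  convert hw using 2
  ring

theorem betti_eq_card_rightEnds {C : Finset (Fin (m + 3))} (hC : C ≠ univ) :
    betti (cycleGraph (m + 3)) C = (rightEnds C).card := by
  classical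
  have hex := exists_add_notMem hC
  let d (x : Fin (m + 3)) : ℕ := Nat.find (hex x)
  let r (x : Fin (m + 3)) : Fin (m + 3) := x + (d x : Fin (m + 3))
  have hrun (x : Fin (m + 3)) (hx : x ∈ C) (j : ℕ) (hj : j ≤ d x) :
      x + (j : Fin (m + 3)) ∈ C := by
    cases j with
    | zero => simpa using hx
    | succ j =>
      have := Nat.find_min (hex x) (m := j) hj
      rw [not_not] at this
      simpa [add_assoc] using this
  have hr (x : Fin (m + 3)) (hx : x ∈ C) : r x ∈ rightEnds C :=
    mem_filter.2 ⟨hrun x hx _ le_rfl, Nat.find_spec (hex x)⟩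
  have hr_self (x : Fin (m + 3)) (hx : x + 1 ∉ C) : r x = x := by
    have : d x = 0 := (Nat.find_eq_zero _).2 (by simpa using hx)
    simp [r, this]
  have hr_succ (x : Fin (m + 3)) (hx : x + 1 ∈ C) : r (x + 1) = r x := by
    have h0 : d x = d (x + 1) + 1 := by
      have hshift : ∃ k : ℕ, x + ((k + 1 : ℕ) : Fin (m + 3)) + 1 ∉ C := by
        obtain ⟨k, hk⟩ := hex (x + 1)
        refine ⟨k, ?_⟩
        convert hk using 2
        push_cast
        ring
      have h := Nat.find_comp_succ (hex x) hshift (by simpa using hx)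
      refine h.trans ?_
      congr 1
      refine Nat.find_congr' ?_
      intro k
      have : x + ((k + 1 : ℕ) : Fin (m + 3)) + 1 = x + 1 + (k : Fin (m + 3)) + 1 := by
        push_cast
        ring
      rw [this]
    simp only [r, h0]
    push_cast
    ring
  let H := SimpleGraph.induce (↑C : Set (Fin (m + 3))) (cycleGraph (m + 3))
  have hadj (x y : (↑C : Set (Fin (m + 3)))) (h : H.Adj x y) : r x = r y := by
    rcases (cycleGraph_adj_iff x.1 y.1).1 h with h | h
    · rw [h, hr_succ _ (h ▸ y.2)]
    · rw [h, hr_succ _ (h ▸ x.2)]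
  have hreach (x y : (↑C : Set (Fin (m + 3)))) (h : H.Reachable x y) : r x = r y := by
    obtain ⟨p⟩ := h
    induction p with
    | nil => rfl
    | cons h _ ih => exact (hadj _ _ h).trans ih
  let f : rightEnds C → H.ConnectedComponent := fun x =>
    H.connectedComponentMk ⟨x.1, (mem_filter.1 x.2).1⟩
  have hf : Function.Bijective f := by
    constructor
    · intro x y hxy
      have h := hreach _ _ (SimpleGraph.ConnectedComponent.eq.1 hxy)
      rw [hr_self _ (mem_filter.1 x.2).2, hr_self _ (mem_filter.1 y.2).2] at h
      exact Subtype.ext h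
    · intro c
      induction c using SimpleGraph.ConnectedComponent.ind with | _ x
      refine ⟨⟨r x, hr _ x.2⟩, SimpleGraph.ConnectedComponent.eq.2 ?_⟩
      exact (reachable_add C (d x) x (hrun x x.2) x.2 (hrun x x.2 _ le_rfl)).symm
  rw [betti, ← Nat.card_congr (Equiv.ofBijective f hf), Nat.card_eq_fintype_card,
    Fintype.card_coe]

theorem card_rightEnds_insert {C : Finset (Fin (m + 3))} {v : Fin (m + 3)} (hv : v ∉ C) :
    (rightEnds (insert v C)).card + (if v - 1 ∈ C then 1 else 0)
      = (rightEnds C).card + (if v + 1 ∈ C then 0 else 1) := by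
  have h1 : rightEnds (insert v C) =
      (rightEnds C).erase (v - 1) ∪ (if v + 1 ∈ C then ∅ else {v}) := by
    ext i
    have hi : i = v - 1 ↔ i + 1 = v := eq_sub_iff_add_eq
    simp only [rightEnds, mem_filter, mem_insert, mem_union, mem_erase, hi, ne_eq]
    by_cases hiv : i = v
    · subst hiv
      split_ifs with h <;> simp [h, hv]
    · split_ifs <;> simp [hiv] <;> tauto
  have h2 : Disjoint ((rightEnds C).erase (v - 1))
      (if v + 1 ∈ C then (∅ : Finset (Fin (m + 3))) else {v}) := by
    split_ifs <;> simp [rightEnds, hv]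
  have h3 : v - 1 ∈ rightEnds C ↔ v - 1 ∈ C := by simp [rightEnds, hv]
  rw [h1, card_union_of_disjoint h2, card_erase_eq_ite]
  simp only [h3]
  by_cases ha : v - 1 ∈ C
  · have : 0 < (rightEnds C).card := card_pos.2 ⟨_, h3.2 ha⟩
    simp only [ha, if_true]
    split_ifs <;> simp <;> omega
  · simp only [ha, if_false]
    split_ifs <;> simp

theorem abs_betti_insert_sub {C : Finset (Fin (m + 3))} {v : Fin (m + 3)} (hv : v ∉ C) :
    |((betti (cycleGraph (m + 3)) (insert v C) : ℝ)) - (betti (cycleGraph (m + 3)) C : ℝ)|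
      = (if v - 1 ∉ C ∧ v + 1 ∉ C then 1 else 0) + (if v - 1 ∈ C ∧ v + 1 ∈ C then 1 else 0)
        - (if C = univ.erase v then 1 else 0) := by
  have hC : C ≠ univ := fun h => hv (h ▸ mem_univ v)
  have hcard := card_rightEnds_insert hv
  rw [betti_eq_card_rightEnds hC]
  by_cases hfull : C = univ.erase v
  · have hins : insert v C = univ := by rw [hfull, insert_erase (mem_univ v)]
    have ha : v - 1 ∈ C := by simp [hfull]
    have hb : v + 1 ∈ C := by simp [hfull]
    have hu : (rightEnds (univ : Finset (Fin (m + 3)))).card = 0 := by simp [rightEnds]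
    rw [hins, hu] at hcard
    simp only [ha, hb, if_true] at hcard
    rw [hins, betti_univ, if_pos hfull]
    have hone : (rightEnds C).card = 1 := by omega
    simp [ha, hb, hone]
  · have hins : insert v C ≠ univ := fun h => hfull (by rw [← h, erase_insert hv])
    rw [betti_eq_card_rightEnds hins, if_neg hfull]
    have hcast : ((rightEnds (insert v C)).card : ℝ) + (if v - 1 ∈ C then 1 else 0)
        = (rightEnds C).card + (if v + 1 ∈ C then 0 else 1) := by
      exact_mod_cast hcard
    have hdiff : ((rightEnds (insert v C)).card : ℝ) - (rightEnds C).card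
        = (if v + 1 ∈ C then 0 else 1) - (if v - 1 ∈ C then 1 else 0) := by linarith
    rw [hdiff]
    by_cases ha : v - 1 ∈ C <;> by_cases hb : v + 1 ∈ C <;> simp [ha, hb]

/-- The Shapley weight of a coalition of size `k` among `n` players. -/
noncomputable def weight (n k : ℕ) : ℝ :=
  (k.factorial : ℝ) * ((n - k - 1).factorial : ℝ) / (n.factorial : ℝ)

theorem weight_symm {n k : ℕ} (hk : k ≤ n - 1) : weight n (n - 1 - k) = weight n k := by
  by_cases hn : n = 0
  · subst hn
    simp_all
  · have h1 : n - (n - 1 - k) - 1 = k := by omega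
    have h2 : n - 1 - k = n - k - 1 := by omega
    rw [weight, weight, h1, h2, mul_comm]

theorem sum_range_succ_mul_succ (k : ℕ) :
    ∑ j ∈ range k, ((j : ℝ) + 1) * (j + 2) = k * (k + 1) * (k + 2) / 3 := by
  induction k with
  | zero => simp
  | succ k ih =>
    rw [sum_range_succ, ih]
    push_cast
    ring

theorem sum_choose_mul_weight (m : ℕ) :
    ∑ k ∈ range (m + 1), (m.choose k : ℝ) * weight (m + 3) k = 1 / 3 := by
  have hterm : ∀ j ∈ range (m + 1), (m.choose (m - j) : ℝ) * weight (m + 3) (m - j)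
      = ((j : ℝ) + 1) * (j + 2) * (1 / ((m + 1) * (m + 2) * (m + 3))) := by
    intro j hj
    have hjm : j ≤ m := Nat.lt_succ_iff.1 (mem_range.1 hj)
    have hc := Nat.choose_mul_factorial_mul_factorial (Nat.sub_le m j)
    rw [Nat.sub_sub_self hjm] at hc
    have hc' : (m.choose (m - j) : ℝ) * (m - j).factorial * j.factorial = m.factorial := by
      exact_mod_cast hc
    have hsub : m + 3 - (m - j) - 1 = j + 2 := by omega
    have hm0 : (m.factorial : ℝ) ≠ 0 := by positivity
    have hfac : ((m + 3).factorial : ℝ) = (m + 3) * (m + 2) * (m + 1) * m.factorial := by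
      simp only [Nat.factorial_succ]
      push_cast
      ring
    have hfac' : ((j + 2).factorial : ℝ) = (j + 2) * (j + 1) * j.factorial := by
      simp only [Nat.factorial_succ]
      push_cast
      ring
    rw [weight, hsub, hfac, hfac']
    field_simp
    linear_combination hc'
  rw [← sum_range_reflect]
  simp only [Nat.add_sub_cancel]
  rw [sum_congr rfl hterm, ← sum_mul, sum_range_succ_mul_succ]
  push_cast
  field_simp
  ring

theorem sum_weight_neither (v : Fin (m + 3)) :
    ∑ C ∈ (univ.erase v).powerset with v - 1 ∉ C ∧ v + 1 ∉ C, weight (m + 3) C.card = 1 / 3 := by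
  have hne : v + 1 ≠ v - 1 := by
    intro h
    have h2 : (1 : Fin (m + 3)) + 1 = 0 := by
      rw [eq_sub_iff_add_eq, add_assoc] at h
      simpa using h
    have := congrArg Fin.val h2
    rw [Fin.val_add, Fin.val_one, Fin.val_zero, Nat.mod_eq_of_lt (by omega)] at this
    omega
  have hset : (univ.erase v).powerset.filter (fun C => v - 1 ∉ C ∧ v + 1 ∉ C)
      = (((univ.erase v).erase (v - 1)).erase (v + 1)).powerset := by
    ext C
    simp only [mem_filter, mem_powerset, subset_erase]
    tauto
  have hcard : (((univ.erase v).erase (v - 1)).erase (v + 1)).card = m := by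
    rw [card_erase_of_mem (by simp [hne]), card_erase_of_mem (by simp),
      card_erase_of_mem (mem_univ v), card_univ, Fintype.card_fin]
    omega
  rw [hset, sum_powerset_apply_card (weight (m + 3)), hcard]
  simp only [nsmul_eq_mul]
  exact sum_choose_mul_weight m

theorem sum_weight_both (v : Fin (m + 3)) :
    ∑ C ∈ (univ.erase v).powerset with v - 1 ∈ C ∧ v + 1 ∈ C, weight (m + 3) C.card = 1 / 3 := by
  rw [← sum_weight_neither v]
  have hcard : (univ.erase v).card = m + 2 := by simp
  refine sum_bij' (fun C _ => univ.erase v \ C) (fun C _ => univ.erase v \ C) ?_ ?_ ?_ ?_ ?_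
  · intro C hC
    simp_all
  · intro C hC
    simp_all
  · intro C hC
    exact Finset.sdiff_sdiff_eq_self (mem_powerset.1 (mem_filter.1 hC).1)
  · intro C hC
    exact Finset.sdiff_sdiff_eq_self (mem_powerset.1 (mem_filter.1 hC).1)
  · intro C hC
    have hsub := mem_powerset.1 (mem_filter.1 hC).1
    have hle := card_le_card hsub
    rw [card_sdiff_of_subset hsub, hcard]
    exact (weight_symm (n := m + 3) (by omega)).symm

theorem weight_pred (n : ℕ) : weight (n + 1) n = 1 / ((n : ℝ) + 1) := by
  have : (n.factorial : ℝ) ≠ 0 := by positivity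
  rw [weight, Nat.factorial_succ]
  simp
  field_simp

end CycleShapley

/-- For the cycle graph `C_n` on `n ≥ 3` vertices, the Shapley influence
value of every vertex equals `2/3 − 1/n`. -/
theorem shapley_cycleGraph (n : ℕ) (hn : 3 ≤ n) (v : Fin n) :
    shapley (cycleGraph n) v = 2 / 3 - 1 / (n : ℝ) := by
  obtain ⟨m, rfl⟩ : ∃ m, n = m + 3 := ⟨n - 3, by omega⟩
  have hterm : ∀ C ∈ (univ.erase v).powerset,
      ((C.card.factorial : ℝ) * ((Fintype.card (Fin (m + 3)) - C.card - 1).factorial : ℝ)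
        / ((Fintype.card (Fin (m + 3))).factorial : ℝ)) *
      |((betti (cycleGraph (m + 3)) (insert v C) : ℝ)) - ((betti (cycleGraph (m + 3)) C : ℝ))|
      = (if v - 1 ∉ C ∧ v + 1 ∉ C then CycleShapley.weight (m + 3) C.card else 0)
        + (if v - 1 ∈ C ∧ v + 1 ∈ C then CycleShapley.weight (m + 3) C.card else 0)
        - (if C = univ.erase v then CycleShapley.weight (m + 3) C.card else 0) := by
    intro C hC
    have hv : v ∉ C := fun h => notMem_erase v univ (mem_powerset.1 hC h)
    rw [CycleShapley.abs_betti_insert_sub hv, Fintype.card_fin, ← CycleShapley.weight, mul_sub,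
      mul_add]
    simp only [mul_ite, mul_one, mul_zero]
  rw [shapley, sum_congr rfl hterm, sum_sub_distrib, sum_add_distrib, ← sum_filter, ← sum_filter,
    CycleShapley.sum_weight_neither, CycleShapley.sum_weight_both, sum_ite_eq',
    if_pos (mem_powerset_self _), card_erase_of_mem (mem_univ v), card_univ, Fintype.card_fin,
    Nat.add_sub_cancel_right (m := 1) (n := m + 2), CycleShapley.weight_pred]
  push_cast
  ring
end

section
/- For the wheel graph W_n on n ≥ 4 vertices, the Shapley influence value of every periphery vertex equals 1/3 − 1/(n(n−1)). -/
open Finset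

/-- The wheel graph with `m` periphery vertices (a cycle on `Fin m`) and a
center `none` adjacent to every periphery vertex; it has `m + 1` vertices. -/
def wheelGraph (m : ℕ) : SimpleGraph (Option (Fin m)) :=
  SimpleGraph.fromRel (fun a b =>
    a = none ∨ ∃ i j, a = some i ∧ b = some j ∧ (i.val + 1) % m = j.val)

/-- The components of the subgraph induced on `C` that contain a neighbor of `v`. -/
def adjacentComponents {V : Type*} (G : SimpleGraph V) (C : Finset V) (v : V) :
    Set (SimpleGraph.induce (↑C : Set V) G).ConnectedComponent :=
  (SimpleGraph.induce (↑C : Set V) G).connectedComponentMk '' {y | G.Adj v y}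

theorem mem_adjacentComponents_iff {V : Type*} {G : SimpleGraph V} {C : Finset V} {v : V}
    {c : (SimpleGraph.induce (↑C : Set V) G).ConnectedComponent} :
    c ∈ adjacentComponents G C v ↔ ∃ y, ∃ hy : y ∈ C, G.Adj v y ∧
      (SimpleGraph.induce (↑C : Set V) G).connectedComponentMk ⟨y, hy⟩ = c := by
  simp [adjacentComponents]

/-- Adding `v` to `C` merges the components adjacent to `v` into a single one. -/
theorem betti_insert {V : Type*} [DecidableEq V] (G : SimpleGraph V) {C : Finset V} {v : V}
    (hv : v ∉ C) :
    betti G (insert v C) + (adjacentComponents G C v).ncard = betti G C + 1 := by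
  classical
  set H := SimpleGraph.induce (↑C : Set V) G with hH
  set K := SimpleGraph.induce (↑(insert v C) : Set V) G with hK
  set S : Set H.ConnectedComponent := adjacentComponents G C v with hS
  have mem_of_ne : ∀ x : (↑(insert v C) : Set V), x.1 ≠ v → x.1 ∈ (↑C : Set V) := fun x hx =>
    (Finset.mem_insert.1 x.2).resolve_left hx
  let toVertex (x : (↑(insert v C) : Set V)) : Option {c // c ∉ S} :=
    if h : x.1 = v then none
    else if h' : H.connectedComponentMk ⟨x.1, mem_of_ne x h⟩ ∈ S then none
    else some ⟨_, h'⟩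
  have toVertex_adj : ∀ x y, K.Adj x y → toVertex x = toVertex y := by
    intro x y hxy
    have hG : G.Adj x.1 y.1 := hxy
    by_cases hx : x.1 = v <;> by_cases hy : y.1 = v
    · simp [toVertex, hx, hy]
    · have : H.connectedComponentMk ⟨y.1, mem_of_ne y hy⟩ ∈ S :=
        ⟨_, by simpa [← hx] using hG, rfl⟩
      simp [toVertex, hx, hy, this]
    · have : H.connectedComponentMk ⟨x.1, mem_of_ne x hx⟩ ∈ S :=
        ⟨_, by simpa [← hy] using hG.symm, rfl⟩
      simp [toVertex, hx, hy, this]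
    · have hadj : H.Adj ⟨x.1, mem_of_ne x hx⟩ ⟨y.1, mem_of_ne y hy⟩ := hG
      have := SimpleGraph.ConnectedComponent.sound hadj.reachable
      simp only [toVertex, hx, hy, this, dite_false]
  have toVertex_walk : ∀ {x y}, K.Walk x y → toVertex x = toVertex y := by
    intro x y p
    induction p with
    | nil => rfl
    | cons hadj _ ih => exact (toVertex_adj _ _ hadj).trans ih
  let incl : H →g K := SimpleGraph.induceHomOfLE G (by simp) |>.toHom
  let vK : (↑(insert v C) : Set V) := ⟨v, by simp⟩
  let e : K.ConnectedComponent ≃ Option {c // c ∉ S} :=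
    { toFun := SimpleGraph.ConnectedComponent.lift toVertex fun _ _ p _ => toVertex_walk p
      invFun := fun o => o.elim (K.connectedComponentMk vK) fun c => c.1.map incl
      left_inv := by
        intro c
        induction c using SimpleGraph.ConnectedComponent.ind with | _ x
        change Option.elim (toVertex x) _ _ = _
        by_cases hx : x.1 = v
        · have : x = vK := Subtype.ext hx
          simp [toVertex, this, vK]
        by_cases hc : H.connectedComponentMk ⟨x.1, mem_of_ne x hx⟩ ∈ S
        · simp only [toVertex, hx, hc, dite_false, dite_true, Option.elim]
          obtain ⟨y, hy, hyx⟩ := hc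
          have h1 : K.Adj vK (incl y) := hy
          have h2 := (SimpleGraph.ConnectedComponent.exact hyx).map incl
          exact SimpleGraph.ConnectedComponent.sound (h1.reachable.trans h2)
        · simp only [toVertex, hx, hc, dite_false, Option.elim]
          rfl
      right_inv := by
        rintro (_ | ⟨c, hc⟩)
        · change toVertex vK = none
          simp [toVertex, vK]
        · induction c using SimpleGraph.ConnectedComponent.ind with | _ x
          change toVertex (incl x) = _
          have hx : (incl x).1 ≠ v := fun h => hv (h ▸ x.2)
          have hc' : H.connectedComponentMk ⟨(incl x).1, mem_of_ne _ hx⟩ ∉ S := hc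
          simp only [toVertex, hx, hc', dite_false]
          rfl }
  have hcard : betti G (insert v C) = Nat.card {c // c ∉ S} + 1 := by
    rw [betti, Nat.card_congr e, Finite.card_option]
  have hcompl : S.ncard + Sᶜ.ncard = betti G C := Set.ncard_add_ncard_compl S
  have : Sᶜ.ncard = Nat.card {c // c ∉ S} := rfl
  omega

theorem wheelGraph_adj_none_some {m : ℕ} (i : Fin m) : (wheelGraph m).Adj none (some i) := by
  simp [wheelGraph]

theorem wheelGraph_adj_some_some {m : ℕ} (i j : Fin m) :
    (wheelGraph m).Adj (some i) (some j) ↔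
      i ≠ j ∧ ((i.val + 1) % m = j.val ∨ (j.val + 1) % m = i.val) := by
  simp [wheelGraph]

/-- The periphery vertex reached from `v` after `k` steps around the cycle. -/
def cycleShift {m : ℕ} (v : Fin m) (k : ℕ) : Fin m :=
  ⟨(v.val + k) % m, Nat.mod_lt _ v.pos⟩

theorem succ_mod_eq_iff {m i j : ℕ} (hi : i < m) (hj : j < m) :
    (i + 1) % m = j ↔ j = i + 1 ∨ (i + 1 = m ∧ j = 0) := by
  rcases Nat.lt_or_ge (i + 1) m with h | h
  · rw [Nat.mod_eq_of_lt h]; omega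
  · obtain rfl : i + 1 = m := by omega
    simp; omega

theorem cycleShift_val {m : ℕ} (v : Fin m) {k : ℕ} (hk : k < m) :
    (cycleShift v k).val = if v.val + k < m then v.val + k else v.val + k - m := by
  have := v.isLt
  unfold cycleShift
  split_ifs with h
  · exact Nat.mod_eq_of_lt h
  · change (v.val + k) % m = _
    rw [Nat.mod_eq_sub_mod (by omega), Nat.mod_eq_of_lt (by omega)]

theorem exists_cycleShift_eq {m : ℕ} (v i : Fin m) : ∃ k < m, cycleShift v k = i := by
  have := v.isLt
  have := i.isLt
  rcases Nat.lt_or_ge i.val v.val with h | h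
  · refine ⟨i.val + m - v.val, by omega, Fin.ext ?_⟩
    rw [cycleShift_val v (by omega)]; split_ifs <;> omega
  · refine ⟨i.val - v.val, by omega, Fin.ext ?_⟩
    rw [cycleShift_val v (by omega)]; split_ifs <;> omega

theorem cycleShift_zero {m : ℕ} (v : Fin m) : cycleShift v 0 = v :=
  Fin.ext (Nat.mod_eq_of_lt v.isLt)

theorem cycleShift_inj {m : ℕ} (v : Fin m) {k l : ℕ} (hk : k < m) (hl : l < m) :
    cycleShift v k = cycleShift v l ↔ k = l := by
  have := v.isLt
  rw [Fin.ext_iff, cycleShift_val v hk, cycleShift_val v hl]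
  split_ifs <;> omega

theorem wheelGraph_adj_cycleShift {m : ℕ} (hm : 3 ≤ m) (v : Fin m) {k l : ℕ} (hk : k < m)
    (hl : l < m) :
    (wheelGraph m).Adj (some (cycleShift v k)) (some (cycleShift v l)) ↔
      l = k + 1 ∨ k = l + 1 ∨ (k = 0 ∧ l + 1 = m) ∨ (l = 0 ∧ k + 1 = m) := by
  have := v.isLt
  rw [wheelGraph_adj_some_some, succ_mod_eq_iff (Fin.isLt _) (Fin.isLt _),
    succ_mod_eq_iff (Fin.isLt _) (Fin.isLt _), Ne, cycleShift_inj v hk hl,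
    cycleShift_val v hk, cycleShift_val v hl]
  split_ifs <;> omega

theorem wheelGraph_adj_iff {m : ℕ} (hm : 3 ≤ m) (v : Fin m) (x : Option (Fin m)) :
    (wheelGraph m).Adj (some v) x ↔
      x = none ∨ x = some (cycleShift v 1) ∨ x = some (cycleShift v (m - 1)) := by
  rcases x with _ | i
  · simpa using (wheelGraph_adj_none_some v).symm
  · obtain ⟨k, hk, rfl⟩ := exists_cycleShift_eq v i
    have := wheelGraph_adj_cycleShift hm v (k := 0) (by omega) hk
    rw [cycleShift_zero] at this
    simp only [this, reduceCtorEq, false_or, true_and, Option.some.injEq]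
    rw [cycleShift_inj v hk (show 1 < m by omega), cycleShift_inj v hk (show m - 1 < m by omega)]
    omega

/-- In the induced subgraph on a set of periphery vertices missing `v`, the two neighbors of `v`
are connected exactly when no other periphery vertex is missing. -/
theorem wheelGraph_neighbors_reachable_iff {m : ℕ} (hm : 3 ≤ m) {v : Fin m}
    {C : Finset (Option (Fin m))} (hv : some v ∉ C) (hnone : none ∉ C)
    (hr : some (cycleShift v 1) ∈ C) (hl : some (cycleShift v (m - 1)) ∈ C) :
    (SimpleGraph.induce (↑C : Set (Option (Fin m))) (wheelGraph m)).Reachable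
      ⟨some (cycleShift v 1), hr⟩ ⟨some (cycleShift v (m - 1)), hl⟩ ↔
      ∀ i, i ≠ v → some i ∈ C := by
  constructor
  · intro hreach i hi
    by_contra hiC
    obtain ⟨w, hw, rfl⟩ := exists_cycleShift_eq v i
    have hw1 : w ≠ 1 := by rintro rfl; exact hiC hr
    have hw0 : w ≠ 0 := by rintro rfl; exact hi (cycleShift_zero v)
    have hwm : w ≠ m - 1 := by rintro rfl; exact hiC hl
    have key : ∀ y, (SimpleGraph.induce (↑C : Set (Option (Fin m))) (wheelGraph m)).Reachable
        ⟨some (cycleShift v 1), hr⟩ y → ∃ k < w, y.1 = some (cycleShift v k) := by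
      intro y hy
      rw [SimpleGraph.reachable_iff_reflTransGen] at hy
      induction hy with
      | refl => exact ⟨1, by omega, rfl⟩
      | @tail y z _ hadj ih =>
        obtain ⟨k, hk, hyk⟩ := ih
        have hk0 : k ≠ 0 := by
          rintro rfl
          rw [cycleShift_zero] at hyk
          exact hv (hyk ▸ y.2)
        obtain ⟨z, hz⟩ := z
        rcases z with _ | j
        · exact (hnone hz).elim
        obtain ⟨l, hlm, rfl⟩ := exists_cycleShift_eq v j
        refine ⟨l, ?_, rfl⟩
        have hG : (wheelGraph m).Adj y.1 (some (cycleShift v l)) := hadj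
        rw [hyk, wheelGraph_adj_cycleShift hm v (by omega) hlm] at hG
        have : l ≠ 0 := by
          rintro rfl
          rw [cycleShift_zero] at hz
          exact hv hz
        have : l ≠ w := by rintro rfl; exact hiC hz
        omega
    obtain ⟨k, hk, hk'⟩ := key _ hreach
    have := (cycleShift_inj v (by omega) (by omega)).1 (Option.some.inj hk')
    omega
  · intro hall
    have hmem : ∀ k, k + 1 < m → some (cycleShift v (k + 1)) ∈ C := by
      intro k hk
      refine hall _ fun h => ?_
      have := (cycleShift_inj v hk (by omega)).1 (h.trans (cycleShift_zero v).symm)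
      omega
    have key : ∀ k (hk : k + 1 < m),
        (SimpleGraph.induce (↑C : Set (Option (Fin m))) (wheelGraph m)).Reachable
        ⟨some (cycleShift v 1), hr⟩ ⟨some (cycleShift v (k + 1)), hmem k hk⟩ := by
      intro k
      induction k with
      | zero => intro _; rfl
      | succ k ih =>
        intro hk
        refine (ih (by omega)).trans (SimpleGraph.Adj.reachable ?_)
        exact (wheelGraph_adj_cycleShift hm v (by omega) hk).2 (Or.inl rfl)
    obtain ⟨k, rfl⟩ : ∃ k, m = k + 2 := ⟨m - 2, by omega⟩
    exact key k (by omega)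

/-- The sum of Shapley weights over the sets containing `a` given elements and avoiding `b`
others. -/
theorem sum_powerset_factorial {α : Type*} [DecidableEq α] (D : Finset α) (a b : ℕ) :
    ∑ X ∈ D.powerset, ((a + #X).factorial : ℝ) * ((b + (#D - #X)).factorial : ℝ)
        / ((a + b + #D + 1).factorial : ℝ) =
      (a.factorial : ℝ) * b.factorial / (a + b + 1).factorial := by
  induction D using Finset.induction_on generalizing a b with
  | empty => simp
  | insert x D hx ih =>
    rw [Finset.sum_powerset_insert hx]
    have h1 := ih a (b + 1)
    have h2 := ih (a + 1) b
    have e1 : ∀ X ∈ D.powerset, ((a + #X).factorial : ℝ) *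
        ((b + (#(insert x D) - #X)).factorial : ℝ) / ((a + b + #(insert x D) + 1).factorial : ℝ) =
        ((a + #X).factorial : ℝ) * ((b + 1 + (#D - #X)).factorial : ℝ)
        / ((a + (b + 1) + #D + 1).factorial : ℝ) := by
      intro X hX
      have := Finset.card_le_card (Finset.mem_powerset.1 hX)
      rw [Finset.card_insert_of_notMem hx, show b + (#D + 1 - #X) = b + 1 + (#D - #X) by omega,
        show a + b + (#D + 1) + 1 = a + (b + 1) + #D + 1 by omega]
    have e2 : ∀ X ∈ D.powerset, ((a + #(insert x X)).factorial : ℝ) *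
        ((b + (#(insert x D) - #(insert x X))).factorial : ℝ)
          / ((a + b + #(insert x D) + 1).factorial : ℝ) =
        ((a + 1 + #X).factorial : ℝ) * ((b + (#D - #X)).factorial : ℝ)
        / ((a + 1 + b + #D + 1).factorial : ℝ) := by
      intro X hX
      have hxX : x ∉ X := fun h => hx (Finset.mem_powerset.1 hX h)
      rw [Finset.card_insert_of_notMem hx, Finset.card_insert_of_notMem hxX,
        show #D + 1 - (#X + 1) = #D - #X by omega, show a + (#X + 1) = a + 1 + #X by omega,
        show a + b + (#D + 1) + 1 = a + 1 + b + #D + 1 by omega]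
    rw [Finset.sum_congr rfl e1, Finset.sum_congr rfl e2, h1, h2,
      show a + (b + 1) + 1 = (a + b + 1) + 1 by omega,
      show a + 1 + b + 1 = (a + b + 1) + 1 by omega,
      Nat.factorial_succ (a + b + 1), Nat.factorial_succ a, Nat.factorial_succ b]
    have := Nat.factorial_ne_zero (a + b + 1)
    push_cast
    field_simp
    ring

section Difference

variable {m : ℕ} {v : Fin m} {C : Finset (Option (Fin m))}

theorem betti_insert_of_center_mem (hv : some v ∉ C) (hnone : none ∈ C) :
    betti (wheelGraph m) (insert (some v) C) = betti (wheelGraph m) C := by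
  have h := betti_insert (wheelGraph m) hv
  have : adjacentComponents (wheelGraph m) C (some v) =
      {SimpleGraph.connectedComponentMk _ ⟨none, hnone⟩} := by
    ext c
    rw [mem_adjacentComponents_iff, Set.mem_singleton_iff]
    constructor
    · rintro ⟨y, hy, -, rfl⟩
      rcases y with _ | i
      · rfl
      · have hadj : (SimpleGraph.induce (↑C : Set (Option (Fin m))) (wheelGraph m)).Adj
            ⟨none, hnone⟩ ⟨some i, hy⟩ := wheelGraph_adj_none_some i
        exact (SimpleGraph.ConnectedComponent.sound hadj.reachable).symm
    · rintro rfl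
      exact ⟨none, hnone, (wheelGraph_adj_none_some v).symm, rfl⟩
  rw [this, Set.ncard_singleton] at h
  omega

theorem betti_insert_of_neighbors_notMem (hm : 3 ≤ m) (hv : some v ∉ C) (hnone : none ∉ C)
    (hr : some (cycleShift v 1) ∉ C) (hl : some (cycleShift v (m - 1)) ∉ C) :
    betti (wheelGraph m) (insert (some v) C) = betti (wheelGraph m) C + 1 := by
  have h := betti_insert (wheelGraph m) hv
  have : adjacentComponents (wheelGraph m) C (some v) = ∅ := by
    ext c
    simp only [mem_adjacentComponents_iff, wheelGraph_adj_iff hm, Set.mem_empty_iff_false,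
      iff_false]
    rintro ⟨y, hy, rfl | rfl | rfl, -⟩ <;> contradiction
  rwa [this, Set.ncard_empty] at h

theorem betti_insert_of_right_mem (hm : 3 ≤ m) (hv : some v ∉ C) (hnone : none ∉ C)
    (hr : some (cycleShift v 1) ∈ C) (hl : some (cycleShift v (m - 1)) ∉ C) :
    betti (wheelGraph m) (insert (some v) C) = betti (wheelGraph m) C := by
  have h := betti_insert (wheelGraph m) hv
  have : adjacentComponents (wheelGraph m) C (some v) =
      {SimpleGraph.connectedComponentMk _ ⟨some (cycleShift v 1), hr⟩} := by
    ext c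
    simp only [mem_adjacentComponents_iff, wheelGraph_adj_iff hm, Set.mem_singleton_iff]
    constructor
    · rintro ⟨y, hy, rfl | rfl | rfl, rfl⟩ <;> first | rfl | contradiction
    · rintro rfl
      exact ⟨_, hr, by simp, rfl⟩
  rw [this, Set.ncard_singleton] at h
  omega

theorem betti_insert_of_left_mem (hm : 3 ≤ m) (hv : some v ∉ C) (hnone : none ∉ C)
    (hr : some (cycleShift v 1) ∉ C) (hl : some (cycleShift v (m - 1)) ∈ C) :
    betti (wheelGraph m) (insert (some v) C) = betti (wheelGraph m) C := by
  have h := betti_insert (wheelGraph m) hv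
  have : adjacentComponents (wheelGraph m) C (some v) =
      {SimpleGraph.connectedComponentMk _ ⟨some (cycleShift v (m - 1)), hl⟩} := by
    ext c
    simp only [mem_adjacentComponents_iff, wheelGraph_adj_iff hm, Set.mem_singleton_iff]
    constructor
    · rintro ⟨y, hy, rfl | rfl | rfl, rfl⟩ <;> first | rfl | contradiction
    · rintro rfl
      exact ⟨_, hl, by simp, rfl⟩
  rw [this, Set.ncard_singleton] at h
  omega

theorem adjacentComponents_of_neighbors_mem (hm : 3 ≤ m) (hnone : none ∉ C)
    (hr : some (cycleShift v 1) ∈ C) (hl : some (cycleShift v (m - 1)) ∈ C) :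
    adjacentComponents (wheelGraph m) C (some v) =
      {SimpleGraph.connectedComponentMk _ ⟨some (cycleShift v 1), hr⟩,
        SimpleGraph.connectedComponentMk _ ⟨some (cycleShift v (m - 1)), hl⟩} := by
  ext c
  simp only [mem_adjacentComponents_iff, wheelGraph_adj_iff hm, Set.mem_singleton_iff,
    Set.mem_insert_iff]
  constructor
  · rintro ⟨y, hy, rfl | rfl | rfl, rfl⟩
    · contradiction
    · exact Or.inl rfl
    · exact Or.inr rfl
  · rintro (rfl | rfl)
    · exact ⟨_, hr, by simp, rfl⟩
    · exact ⟨_, hl, by simp, rfl⟩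

theorem betti_insert_of_all_mem (hm : 3 ≤ m) (hv : some v ∉ C) (hnone : none ∉ C)
    (hr : some (cycleShift v 1) ∈ C) (hl : some (cycleShift v (m - 1)) ∈ C)
    (hall : ∀ i, i ≠ v → some i ∈ C) :
    betti (wheelGraph m) (insert (some v) C) = betti (wheelGraph m) C := by
  have h := betti_insert (wheelGraph m) hv
  rw [adjacentComponents_of_neighbors_mem hm hnone hr hl, SimpleGraph.ConnectedComponent.sound
    ((wheelGraph_neighbors_reachable_iff hm hv hnone hr hl).2 hall), Set.pair_eq_singleton,
    Set.ncard_singleton] at h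
  omega

theorem betti_insert_of_neighbors_mem (hm : 3 ≤ m) (hv : some v ∉ C) (hnone : none ∉ C)
    (hr : some (cycleShift v 1) ∈ C) (hl : some (cycleShift v (m - 1)) ∈ C)
    (hall : ¬ ∀ i, i ≠ v → some i ∈ C) :
    betti (wheelGraph m) (insert (some v) C) + 1 = betti (wheelGraph m) C := by
  have h := betti_insert (wheelGraph m) hv
  rw [adjacentComponents_of_neighbors_mem hm hnone hr hl, Set.ncard_pair fun heq => hall
    ((wheelGraph_neighbors_reachable_iff hm hv hnone hr hl).1
      (SimpleGraph.ConnectedComponent.exact heq))] at h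
  omega

end Difference

theorem shapley_wheelGraph_some {m : ℕ} (hm : 3 ≤ m) (v : Fin m) :
    shapley (wheelGraph m) (some v) = 1 / 3 - 1 / (((m : ℝ) + 1) * m) := by
  set r := cycleShift v 1 with hr
  set l := cycleShift v (m - 1) with hl
  have hrl : r ≠ l := by
    rw [hr, hl, Ne, cycleShift_inj v (by omega) (by omega)]; omega
  have hrv : r ≠ v := fun h => by
    have := (cycleShift_inj v (by omega) (by omega)).1 (h.trans (cycleShift_zero v).symm)
    omega
  have hlv : l ≠ v := fun h => by
    have := (cycleShift_inj v (by omega) (by omega)).1 (h.trans (cycleShift_zero v).symm)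
    omega
  set D : Finset (Option (Fin m)) := {some v, none, some r, some l}ᶜ with hD
  have hDn : none ∉ D := by simp [hD]
  have hDr : some r ∉ D := by simp [hD]
  have hDl : some l ∉ D := by simp [hD]
  have hDv : some v ∉ D := by simp [hD]
  have hDcard : m = #D + 3 := by
    rw [hD, Finset.card_compl, Finset.card_insert_of_notMem (by simp [hrv.symm, hlv.symm]),
      Finset.card_insert_of_notMem (by simp), Finset.card_pair (by simpa using hrl)]
    simp; omega
  have hsplit : (Finset.univ : Finset (Option (Fin m))).erase (some v) =
      insert none (insert (some r) (insert (some l) D)) := by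
    ext x
    by_cases h2 : x = none
    · simp [h2]
    by_cases h3 : x = some r
    · simp [h3, hrv]
    by_cases h4 : x = some l
    · simp [h4, hlv]
    simp [hD, h2, h3, h4]
  have hcardV : Fintype.card (Option (Fin m)) = #D + 4 := by
    rw [Fintype.card_option, Fintype.card_fin]; omega
  have hcenter : ∀ t ∈ (insert (some r) (insert (some l) D)).powerset,
      |((betti (wheelGraph m) (insert (some v) (insert none t)) : ℕ) : ℝ) -
        (betti (wheelGraph m) (insert none t) : ℕ)| = 0 := by
    intro t ht
    have hvt : some v ∉ t := fun h => by
      have := Finset.mem_powerset.1 ht h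
      simp [hrv.symm, hlv.symm, hDv] at this
    rw [betti_insert_of_center_mem (by simpa using hvt) (by simp), sub_self, abs_zero]
  have hsub : ∀ t ∈ D.powerset, some v ∉ t ∧ none ∉ t ∧ some r ∉ t ∧ some l ∉ t := fun t ht =>
    have h := Finset.mem_powerset.1 ht
    ⟨fun h' => hDv (h h'), fun h' => hDn (h h'), fun h' => hDr (h h'), fun h' => hDl (h h')⟩
  have hneither : ∀ t ∈ D.powerset,
      |((betti (wheelGraph m) (insert (some v) t) : ℕ) : ℝ) -
        (betti (wheelGraph m) t : ℕ)| = 1 := by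
    intro t ht
    obtain ⟨h1, h2, h3, h4⟩ := hsub t ht
    rw [betti_insert_of_neighbors_notMem hm h1 h2 h3 h4]
    simp
  have hleft : ∀ t ∈ D.powerset,
      |((betti (wheelGraph m) (insert (some v) (insert (some l) t)) : ℕ) : ℝ) -
        (betti (wheelGraph m) (insert (some l) t) : ℕ)| = 0 := by
    intro t ht
    obtain ⟨h1, h2, h3, h4⟩ := hsub t ht
    rw [betti_insert_of_left_mem hm (by simp [h1, hlv.symm]) (by simp [h2])
      (by rw [← hr]; simp [h3, hrl]) (by simp [hl]), sub_self, abs_zero]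
  have hright : ∀ t ∈ D.powerset,
      |((betti (wheelGraph m) (insert (some v) (insert (some r) t)) : ℕ) : ℝ) -
        (betti (wheelGraph m) (insert (some r) t) : ℕ)| = 0 := by
    intro t ht
    obtain ⟨h1, h2, h3, h4⟩ := hsub t ht
    rw [betti_insert_of_right_mem hm (by simp [h1, hrv.symm]) (by simp [h2])
      (by simp [hr]) (by rw [← hl]; simp [h4, hrl.symm]), sub_self, abs_zero]
  have hboth : ∀ t ∈ D.powerset,
      |((betti (wheelGraph m) (insert (some v) (insert (some r) (insert (some l) t))) : ℕ) : ℝ) -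
        (betti (wheelGraph m) (insert (some r) (insert (some l) t)) : ℕ)| =
          1 - if t = D then 1 else 0 := by
    intro t ht
    obtain ⟨h1, h2, h3, h4⟩ := hsub t ht
    have hv' : some v ∉ insert (some r) (insert (some l) t) := by simp [h1, hrv.symm, hlv.symm]
    have hn' : none ∉ insert (some r) (insert (some l) t) := by simp [h2]
    have hr' : some r ∈ insert (some r) (insert (some l) t) := by simp
    have hl' : some l ∈ insert (some r) (insert (some l) t) := by simp
    by_cases htD : t = D
    · rw [betti_insert_of_all_mem hm hv' hn' hr' hl' fun i hi => ?_]
      · simp [htD]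
      · by_cases h5 : i = r <;> by_cases h6 : i = l <;> simp [htD, hD, h5, h6, hi]
    · rw [← betti_insert_of_neighbors_mem hm hv' hn' hr' hl' fun hall => htD ?_]
      · simp [htD]
      · refine (Finset.mem_powerset.1 ht).antisymm fun x hx => ?_
        rcases x with _ | i
        · exact (hDn hx).elim
        · have hi := hall i fun h => hDv (h ▸ hx)
          have h5 : i ≠ r := fun h => hDr (h ▸ hx)
          have h6 : i ≠ l := fun h => hDl (h ▸ hx)
          simpa [h5, h6] using hi
  unfold shapley
  rw [hsplit, hcardV]
  set f : Finset (Option (Fin m)) → ℝ := fun t =>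
    ((#t).factorial : ℝ) * ((#D + 4 - #t - 1).factorial : ℝ) / ((#D + 4).factorial : ℝ) *
      |((betti (wheelGraph m) (insert (some v) t) : ℕ) : ℝ) - (betti (wheelGraph m) t : ℕ)| with hf
  have hfcenter : ∀ t ∈ (insert (some r) (insert (some l) D)).powerset, f (insert none t) = 0 :=
    fun t ht => by rw [hf]; simp only [hcenter t ht, mul_zero]
  have hfleft : ∀ t ∈ D.powerset, f (insert (some l) t) = 0 :=
    fun t ht => by rw [hf]; simp only [hleft t ht, mul_zero]
  have hfright : ∀ t ∈ D.powerset, f (insert (some r) t) = 0 :=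
    fun t ht => by rw [hf]; simp only [hright t ht, mul_zero]
  rw [Finset.sum_powerset_insert (by simp [hDn]), Finset.sum_eq_zero hfcenter, add_zero,
    Finset.sum_powerset_insert (by simp [hDr, hrl]), Finset.sum_powerset_insert hDl,
    Finset.sum_powerset_insert hDl, Finset.sum_eq_zero hfleft, Finset.sum_eq_zero hfright,
    add_zero, zero_add]
  have hmcast : (m : ℝ) = #D + 3 := by exact_mod_cast hDcard
  have e1 := sum_powerset_factorial D 0 3
  have e2 := sum_powerset_factorial D 2 1
  have hfirst : ∀ t ∈ D.powerset, ((#t).factorial : ℝ) * ((#D + 4 - #t - 1).factorial : ℝ) /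
        ((#D + 4).factorial : ℝ) *
      |((betti (wheelGraph m) (insert (some v) t) : ℕ) : ℝ) - (betti (wheelGraph m) t : ℕ)| =
      ((0 + #t).factorial : ℝ) * ((3 + (#D - #t)).factorial : ℝ)
        / ((0 + 3 + #D + 1).factorial : ℝ) := by
    intro t ht
    have := Finset.card_le_card (Finset.mem_powerset.1 ht)
    rw [hneither t ht, mul_one, show #D + 4 - #t - 1 = 3 + (#D - #t) by omega, zero_add,
      show 0 + 3 + #D + 1 = #D + 4 by omega]
  have hlast : ∀ t ∈ D.powerset,
      ((#(insert (some r) (insert (some l) t))).factorial : ℝ) *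
        ((#D + 4 - #(insert (some r) (insert (some l) t)) - 1).factorial : ℝ) /
        ((#D + 4).factorial : ℝ) *
      |((betti (wheelGraph m) (insert (some v) (insert (some r) (insert (some l) t))) : ℕ) : ℝ) -
        (betti (wheelGraph m) (insert (some r) (insert (some l) t)) : ℕ)| =
      ((2 + #t).factorial : ℝ) * ((1 + (#D - #t)).factorial : ℝ)
        / ((2 + 1 + #D + 1).factorial : ℝ) -
        if t = D then ((#D + 2).factorial : ℝ) / ((#D + 4).factorial : ℝ) else 0 := by
    intro t ht
    have := Finset.card_le_card (Finset.mem_powerset.1 ht)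
    obtain ⟨-, -, h3, h4⟩ := hsub t ht
    rw [hboth t ht, Finset.card_insert_of_notMem (by simp [h3, hrl]),
      Finset.card_insert_of_notMem h4, show #D + 4 - (#t + 1 + 1) - 1 = 1 + (#D - #t) by omega,
      show 2 + 1 + #D + 1 = #D + 4 by omega, show #t + 1 + 1 = 2 + #t by omega]
    split_ifs with h
    · simp [h, add_comm]
    · simp
  rw [Finset.sum_congr rfl hfirst, Finset.sum_congr rfl hlast, Finset.sum_sub_distrib, e1, e2,
    Finset.sum_ite_eq' D.powerset D, if_pos (Finset.mem_powerset_self D), hmcast,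
    Nat.factorial_succ (#D + 3), Nat.factorial_succ (#D + 2)]
  have hfact : ((#D + 2).factorial : ℝ) ≠ 0 := Nat.cast_ne_zero.2 (Nat.factorial_ne_zero _)
  push_cast
  generalize ((#D + 2).factorial : ℝ) = F at hfact ⊢
  generalize (#D : ℝ) = x
  norm_num [Nat.factorial]
  field_simp
  ring

/-- For the wheel graph `W_n` on `n ≥ 4` vertices, the Shapley influence value
of every periphery vertex equals `1/3 − 1/(n(n−1))`. -/
theorem shapley_wheelGraph_periphery (n : ℕ) (hn : 4 ≤ n) (v : Fin (n - 1)) :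
    shapley (wheelGraph (n - 1)) (some v) = 1 / 3 - 1 / ((n : ℝ) * ((n : ℝ) - 1)) := by
  rw [shapley_wheelGraph_some (by omega), Nat.cast_sub (by omega), Nat.cast_one, sub_add_cancel]
end

section
/- For the wheel graph W_n on n ≥ 4 vertices, the Shapley influence value of the center vertex equals (n² − 7n + 18)/(6n). -/
open Finset

section Components

variable {V : Type*} {G : SimpleGraph V} {C : Finset V} {σ : V → V}

/-- If the edges inside `C` are exactly the steps `x, σ x` and every orbit of `σ` leaves `C`, then
each component of `C` contains exactly one vertex from which `σ` exits `C`. -/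
theorem betti_eq_card_exits [DecidableEq V]
    (hadj : ∀ x ∈ C, ∀ y ∈ C, G.Adj x y → y = σ x ∨ x = σ y)
    (hstep : ∀ x ∈ C, σ x ∈ C → G.Adj x (σ x))
    (hexit : ∀ x, ∃ k, σ^[k + 1] x ∉ C) :
    betti G C = #{x ∈ C | σ x ∉ C} := by
  let H := SimpleGraph.induce (↑C : Set V) G
  let e : V → V := fun x => σ^[Nat.find (hexit x)] x
  have e_step (x : V) (hx : σ x ∈ C) : e x = e (σ x) := by
    have h : Nat.find (hexit x) = Nat.find (hexit (σ x)) + 1 :=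
      Nat.find_comp_succ _ _ (by simpa using hx)
    change σ^[Nat.find (hexit x)] x = _
    rw [h]
    rfl
  have e_exit (x : V) (hx : σ x ∉ C) : e x = x := by
    have h : Nat.find (hexit x) = 0 := (Nat.find_eq_zero _).2 (by simpa using hx)
    change σ^[Nat.find (hexit x)] x = _
    rw [h]
    rfl
  have e_const (x y : (↑C : Set V)) (h : H.Reachable x y) : e x = e y := by
    obtain ⟨w⟩ := h
    induction w with
    | nil => rfl
    | @cons u v _ h _ ih =>
      rw [← ih]
      have h' : G.Adj u v := h
      rcases hadj u u.2 v v.2 h' with h | h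
      · rw [h]; exact e_step _ (h ▸ v.2)
      · rw [h]; exact (e_step _ (h ▸ u.2)).symm
  have exists_exit (k : ℕ) : ∀ x : (↑C : Set V), σ^[k + 1] x ∉ C →
      ∃ y : (↑C : Set V), σ y ∉ C ∧ H.Reachable y x := by
    induction k with
    | zero => exact fun x hx => ⟨x, by simpa using hx, .rfl⟩
    | succ k ih =>
      intro x hx
      by_cases hσ : σ x ∈ C
      · obtain ⟨y, hy, hr⟩ := ih ⟨σ x, hσ⟩ hx
        have h : H.Adj ⟨σ x, hσ⟩ x := (hstep x x.2 hσ).symm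
        exact ⟨y, hy, hr.trans h.reachable⟩
      · exact ⟨x, hσ, .rfl⟩
  have mem (y : {x ∈ C | σ x ∉ C}) : y.1 ∈ C ∧ σ y.1 ∉ C := mem_filter.1 y.2
  let f : {x ∈ C | σ x ∉ C} → H.ConnectedComponent :=
    fun y => H.connectedComponentMk ⟨y, (mem y).1⟩
  have hf : f.Bijective := by
    constructor
    · intro y z h
      have h' := e_const _ _ (SimpleGraph.ConnectedComponent.exact h)
      rw [e_exit _ (mem y).2, e_exit _ (mem z).2] at h'
      exact Subtype.ext h'
    · intro K
      induction K using SimpleGraph.ConnectedComponent.ind with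
      | _ x =>
        obtain ⟨k, hk⟩ := hexit x
        obtain ⟨y, hy, hr⟩ := exists_exit k x hk
        exact ⟨⟨y, mem_filter.2 ⟨y.2, hy⟩⟩, SimpleGraph.ConnectedComponent.sound hr⟩
  rw [betti, ← Nat.card_eq_of_bijective f hf, Nat.card_eq_fintype_card, Fintype.card_coe]

/-- A vertex set with a vertex reaching all its vertices has one component. -/
theorem betti_eq_one_of_reachable (c : (↑C : Set V))
    (h : ∀ x, (SimpleGraph.induce (↑C : Set V) G).Reachable c x) : betti G C = 1 := by
  rw [betti, Nat.card_eq_one_iff_exists]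
  refine ⟨(SimpleGraph.induce (↑C : Set V) G).connectedComponentMk c, fun K => ?_⟩
  induction K using SimpleGraph.ConnectedComponent.ind with
  | _ x => exact SimpleGraph.ConnectedComponent.sound (h x).symm

end Components

section Wheel

open scoped Fin.CommRing

variable {p : ℕ}

theorem wheelGraph_adj_some (i j : Fin (p + 2)) :
    (wheelGraph (p + 2)).Adj (some i) (some j) ↔ i ≠ j ∧ (j = i + 1 ∨ i = j + 1) := by
  have step (a b : Fin (p + 2)) : (a.val + 1) % (p + 2) = b.val ↔ b = a + 1 := by
    rw [Fin.ext_iff, Fin.val_add, eq_comm]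
    simp
  simp [wheelGraph, step]

theorem wheelGraph_adj_none (m : ℕ) (i : Fin m) : (wheelGraph m).Adj none (some i) := by
  simp [wheelGraph]

theorem iterate_map_add_one (k : ℕ) (i : Fin (p + 2)) :
    (Option.map (· + 1))^[k] (some i) = some (i + (k : Fin (p + 2))) := by
  induction k generalizing i with
  | zero => simp
  | succ k ih => simp [ih, add_assoc, add_comm (1 : Fin (p + 2))]

theorem betti_insert_none (m : ℕ) (C : Finset (Fin m)) :
    betti (wheelGraph m) (insert none (C.map .some)) = 1 := by
  refine betti_eq_one_of_reachable ⟨none, by simp⟩ ?_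
  rintro ⟨_ | i, hi⟩
  · rfl
  · exact SimpleGraph.Adj.reachable (wheelGraph_adj_none m i)

theorem betti_periphery :
    betti (wheelGraph (p + 2)) ((univ : Finset (Fin (p + 2))).map .some) = 1 := by
  refine betti_eq_one_of_reachable ⟨some 0, by simp⟩ ?_
  have key (k : ℕ) : (SimpleGraph.induce (↑((univ : Finset (Fin (p + 2))).map .some) : Set _)
      (wheelGraph (p + 2))).Reachable ⟨some 0, by simp⟩ ⟨some (k : Fin (p + 2)), by simp⟩ := by
    induction k with
    | zero => simp
    | succ k ih =>
      refine ih.trans (SimpleGraph.Adj.reachable ?_)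
      exact (wheelGraph_adj_some _ _).2 (by simp)
  rintro ⟨_ | i, hi⟩
  · simp at hi
  · simpa using key i

theorem betti_map_some {C : Finset (Fin (p + 2))} (hC : C ≠ univ) :
    betti (wheelGraph (p + 2)) (C.map .some) = #{i ∈ C | i + 1 ∉ C} := by
  rw [betti_eq_card_exits (σ := Option.map (· + 1))]
  · rw [filter_map, card_map]
    congr 1
    ext i
    simp
    grind
  · rintro (_ | i) hi (_ | j) hj h
    · simp at hi
    · simp at hi
    · simp at hj
    · simpa using ((wheelGraph_adj_some i j).1 h).2
  · rintro (_ | i) hi h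
    · simp at hi
    · exact (wheelGraph_adj_some _ _).2 (by simp)
  · rintro (_ | i)
    · exact ⟨0, by simp⟩
    · obtain ⟨j, hj⟩ : ∃ j, j ∉ C := by simpa [Finset.ext_iff] using hC
      refine ⟨(j - i - 1).val, ?_⟩
      rw [iterate_map_add_one]
      simpa using hj

theorem abs_betti_sub (C : Finset (Fin (p + 2))) :
    |(betti (wheelGraph (p + 2)) (insert none (C.map .some)) : ℝ)
        - betti (wheelGraph (p + 2)) (C.map .some)| =
      #{i ∈ C | i + 1 ∉ C} - 1 + (if C = ∅ then 2 else 0) + (if C = univ then 1 else 0) := by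
  rw [betti_insert_none]
  rcases eq_or_ne C univ with rfl | hC
  · simp [betti_periphery, univ_nonempty.ne_empty]
  rw [betti_map_some hC]
  rcases C.eq_empty_or_nonempty with rfl | hne
  · simp [hC]; norm_num
  have hpos : 1 ≤ #{i ∈ C | i + 1 ∉ C} := by
    rw [Nat.one_le_iff_ne_zero, Finset.card_ne_zero]
    by_contra hempty
    have hclosed (i : Fin (p + 2)) (hi : i ∈ C) : i + 1 ∈ C := by
      by_contra h
      exact hempty ⟨i, mem_filter.2 ⟨hi, h⟩⟩
    obtain ⟨i, hi⟩ := hne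
    have key (k : ℕ) : i + (k : Fin (p + 2)) ∈ C := by
      induction k with
      | zero => simpa using hi
      | succ k ih => simpa [add_assoc] using hclosed _ ih
    exact hC (eq_univ_iff_forall.2 fun j => by simpa using key (j - i).val)
  have : (1 : ℝ) ≤ #{i ∈ C | i + 1 ∉ C} := mod_cast hpos
  rw [abs_sub_comm, Nat.cast_one, abs_of_nonneg (by linarith)]
  simp [hC, hne.ne_empty]

end Wheel

section Sums

/-- Each pair `i ≠ j` is separated by `C` in the order `i ∈ C`, `j ∉ C` for the sets
`insert i D` with `D` avoiding both. -/
theorem sum_filter_mem_notMem {α : Type*} [Fintype α] [DecidableEq α] {i j : α} (hij : i ≠ j)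
    (w : ℕ → ℝ) :
    ∑ C : Finset α with i ∈ C ∧ j ∉ C, w #C =
      ∑ k ∈ range (Fintype.card α - 1), (Fintype.card α - 2).choose k * w (k + 1) := by
  have hcard : #((univ.erase i).erase j) = Fintype.card α - 2 := by
    rw [card_erase_of_mem (by simp [hij.symm]), card_erase_of_mem (mem_univ _)]
    rfl
  have hlt : 1 < Fintype.card α := Fintype.one_lt_card_iff.2 ⟨i, j, hij⟩
  have h := sum_powerset_apply_card (fun k => w (k + 1)) (x := (univ.erase i).erase j)
  rw [hcard, show Fintype.card α - 2 + 1 = Fintype.card α - 1 by omega] at h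
  simp only [nsmul_eq_mul] at h
  rw [← h]
  refine sum_nbij' (fun C => C.erase i) (fun D => insert i D) ?_ ?_ ?_ ?_ ?_
  · intro C hC
    simp only [mem_filter, mem_univ, true_and] at hC
    simp only [mem_powerset, subset_iff, mem_erase]
    grind
  · intro D hD
    simp only [mem_powerset, subset_iff, mem_erase] at hD
    simp only [mem_filter, mem_univ, true_and]
    grind
  · intro C hC
    simp only [mem_filter] at hC
    exact insert_erase hC.2.1
  · intro D hD
    refine erase_insert fun hi => ?_
    simpa using mem_powerset.1 hD hi
  · intro C hC
    simp only [mem_filter] at hC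
    rw [card_erase_add_one hC.2.1]

theorem sum_weight (m : ℕ) :
    ∑ C : Finset (Fin m), ((#C).factorial * (m - #C).factorial / (m + 1).factorial : ℝ) = 1 := by
  have h := sum_powerset_apply_card
    (fun k => (k.factorial * (m - k).factorial / (m + 1).factorial : ℝ))
    (x := (univ : Finset (Fin m)))
  rw [powerset_univ, card_univ, Fintype.card_fin] at h
  rw [h]
  have key : ∀ k ∈ range (m + 1),
      m.choose k • (k.factorial * (m - k).factorial / (m + 1).factorial : ℝ) = 1 / (m + 1) := by
    intro k hk
    have := Nat.choose_mul_factorial_mul_factorial (Nat.lt_succ_iff.1 (mem_range.1 hk))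
    have h' : (m.choose k * k.factorial * (m - k).factorial : ℝ) = m.factorial := mod_cast this
    rw [nsmul_eq_mul, mul_div_assoc', ← mul_assoc, h', Nat.factorial_succ]
    push_cast
    have := Nat.cast_ne_zero (R := ℝ).2 m.factorial_ne_zero
    field_simp
  rw [sum_congr rfl key]
  simp
  field_simp

theorem sum_range_succ_mul_sub (p : ℕ) :
    ∑ k ∈ range (p + 1), ((k + 1) * (p + 1 - k) : ℝ) = (p + 1) * (p + 2) * (p + 3) / 6 := by
  have h (q : ℕ) (c : ℝ) : ∑ k ∈ range q, ((k + 1) * (c - k) : ℝ) =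
      c * (q * (q + 1) / 2) - (q - 1) * q * (q + 1) / 3 := by
    induction q with
    | zero => simp
    | succ q ih => rw [sum_range_succ, ih]; push_cast; ring
  rw [h]; push_cast; ring

theorem sum_weight_succ (p : ℕ) :
    ∑ k ∈ range (p + 1), (p.choose k *
      ((k + 1).factorial * (p + 2 - (k + 1)).factorial / (p + 3).factorial) : ℝ) = 1 / 6 := by
  have key : ∀ k ∈ range (p + 1), (p.choose k *
      ((k + 1).factorial * (p + 2 - (k + 1)).factorial / (p + 3).factorial) : ℝ) =
      (k + 1) * (p + 1 - k) / ((p + 1) * (p + 2) * (p + 3)) := by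
    intro k hk
    have hk : k ≤ p := Nat.lt_succ_iff.1 (mem_range.1 hk)
    have h' : (p.choose k * k.factorial * (p - k).factorial : ℝ) = p.factorial :=
      mod_cast Nat.choose_mul_factorial_mul_factorial hk
    rw [show p + 2 - (k + 1) = (p - k) + 1 by omega]
    simp only [Nat.factorial_succ]
    push_cast [Nat.cast_sub hk]
    rw [← h']
    have h1 := Nat.cast_ne_zero (R := ℝ).2 (Nat.choose_pos hk).ne'
    have h2 := Nat.cast_ne_zero (R := ℝ).2 k.factorial_ne_zero
    have h3 := Nat.cast_ne_zero (R := ℝ).2 (p - k).factorial_ne_zero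
    field_simp
    ring
  rw [sum_congr rfl key, ← sum_div, sum_range_succ_mul_sub]
  field_simp

theorem sum_weight_mul_card_exits (p : ℕ) :
    ∑ C : Finset (Fin (p + 2)),
      ((#C).factorial * (p + 2 - #C).factorial / (p + 3).factorial * #{i ∈ C | i + 1 ∉ C} : ℝ) =
      (p + 2) / 6 := by
  have h (C : Finset (Fin (p + 2))) :
      (#{i ∈ C | i + 1 ∉ C} : ℝ) = ∑ i, if i ∈ C ∧ i + 1 ∉ C then 1 else 0 := by
    rw [sum_boole]
    congr 2
    ext i
    simp
  simp_rw [h, mul_sum, mul_ite, mul_one, mul_zero]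
  rw [sum_comm]
  have key (i : Fin (p + 2)) : ∑ C : Finset (Fin (p + 2)), (if i ∈ C ∧ i + 1 ∉ C then
      ((#C).factorial * (p + 2 - #C).factorial / (p + 3).factorial : ℝ) else 0) = 1 / 6 := by
    rw [← sum_filter, sum_filter_mem_notMem (by simp)
      (fun k => (k.factorial * (p + 2 - k).factorial / (p + 3).factorial : ℝ)), Fintype.card_fin]
    exact sum_weight_succ p
  simp_rw [key]
  simp
  ring

end Sums

/-- For the wheel graph `W_n` on `n ≥ 4` vertices, the Shapley influence value
of the center vertex equals `(n² − 7n + 18)/(6n)`. -/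
theorem shapley_wheelGraph_center (n : ℕ) (hn : 4 ≤ n) :
    shapley (wheelGraph (n - 1)) none = ((n : ℝ) ^ 2 - 7 * (n : ℝ) + 18) / (6 * (n : ℝ)) := by
  obtain ⟨p, rfl⟩ : ∃ p, n = p + 3 := ⟨n - 3, by omega⟩
  change shapley (wheelGraph (p + 2)) none = _
  have hsum : shapley (wheelGraph (p + 2)) none = ∑ C : Finset (Fin (p + 2)),
      ((#C).factorial * (p + 2 - #C).factorial / (p + 3).factorial : ℝ) *
      (#{i ∈ C | i + 1 ∉ C} - 1 + (if C = ∅ then 2 else 0) + (if C = univ then 1 else 0)) := by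
    rw [shapley]
    symm
    refine sum_bij (fun C _ => C.map .some) ?_ ?_ ?_ ?_
    · intro C _
      simp [subset_iff]
    · exact fun C _ D _ h => map_injective _ h
    · intro D hD
      refine ⟨eraseNone D, mem_univ _, ?_⟩
      rw [map_some_eraseNone]
      exact erase_eq_of_notMem fun h => by simpa using mem_powerset.1 hD h
    · intro C _
      rw [abs_betti_sub, card_map, Fintype.card_option, Fintype.card_fin,
        show p + 2 + 1 - #C - 1 = p + 2 - #C by omega]
  have hw := sum_weight (p + 2)
  rw [hsum]
  simp only [mul_add, mul_sub, mul_one, sum_add_distrib, sum_sub_distrib,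
    sum_weight_mul_card_exits, hw, mul_ite, mul_zero, sum_ite_eq', mem_univ, if_true]
  have h3 : ((p + 3).factorial : ℝ) = (p + 3) * (p + 2).factorial := by
    rw [Nat.factorial_succ]; push_cast; ring
  have := Nat.cast_ne_zero (R := ℝ).2 (p + 2).factorial_ne_zero
  simp [h3]
  field_simp
  ring
end

section
/- For the star graph S_{n−1} on n ≥ 2 vertices, the Shapley influence value of every leaf (periphery) vertex equals 1/2. -/
open Finset

/-- The star graph with center `none` adjacent to `m` leaves, no edges among leaves. -/
def starGraph (m : ℕ) : SimpleGraph (Option (Fin m)) :=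
  SimpleGraph.fromRel (fun a _ => a = none)

theorem betti_of_dominating {V : Type*} {G : SimpleGraph V} {C : Finset V} {c : V}
    (hc : c ∈ C) (h : ∀ u ∈ C, u ≠ c → G.Adj c u) : betti G C = 1 := by
  unfold betti
  rw [Nat.card_eq_one_iff_unique]
  have key : ∀ x : (C : Set V), (G.induce (C : Set V)).Reachable ⟨c, hc⟩ x := by
    rintro ⟨u, hu⟩
    by_cases huc : u = c
    · subst huc
      exact SimpleGraph.Reachable.refl _
    · exact SimpleGraph.Adj.reachable (h u hu huc)
  refine ⟨⟨fun a b => ?_⟩, ⟨SimpleGraph.connectedComponentMk _ ⟨c, hc⟩⟩⟩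
  induction a using SimpleGraph.ConnectedComponent.ind with | _ x
  induction b using SimpleGraph.ConnectedComponent.ind with | _ y
  exact SimpleGraph.ConnectedComponent.sound ((key x).symm.trans (key y))

theorem betti_of_independent {V : Type*} {G : SimpleGraph V} {C : Finset V}
    (h : ∀ u ∈ C, ∀ w ∈ C, ¬ G.Adj u w) : betti G C = C.card := by
  unfold betti
  have hbot : G.induce (C : Set V) = ⊥ := by
    ext x y
    simpa using h x x.2 y y.2
  have hbij : Function.Bijective
      (SimpleGraph.connectedComponentMk (⊥ : SimpleGraph (C : Set V))) :=
    ⟨fun x y hxy => SimpleGraph.reachable_bot.mp (SimpleGraph.ConnectedComponent.exact hxy),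
      Quot.mk_surjective⟩
  rw [hbot, ← Nat.card_congr (Equiv.ofBijective _ hbij)]
  simp

theorem betti_starGraph {m : ℕ} (C : Finset (Option (Fin m))) :
    betti (starGraph m) C = if none ∈ C then 1 else C.card := by
  split_ifs with hC
  · refine betti_of_dominating hC fun u _ hu => ?_
    simp [starGraph, hu.symm]
  · refine betti_of_independent fun u hu w hw => ?_
    have hu' : u ≠ none := ne_of_mem_of_not_mem hu hC
    have hw' : w ≠ none := ne_of_mem_of_not_mem hw hC
    simp [starGraph, hu', hw']

theorem abs_betti_insert_leaf_sub {m : ℕ} {v : Fin m} {C : Finset (Option (Fin m))}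
    (hv : some v ∉ C) :
    |(betti (starGraph m) (insert (some v) C) : ℝ) - (betti (starGraph m) C : ℝ)| =
      if none ∉ C then 1 else 0 := by
  by_cases hC : none ∈ C <;> simp [betti_starGraph, hC, hv]

theorem choose_mul_shapley_weight {m k : ℕ} (hk : k ≤ m) :
    (m.choose k : ℝ) * ((k.factorial : ℝ) * ((m + 2 - k - 1).factorial : ℝ)
        / ((m + 2).factorial : ℝ)) = ((m : ℝ) + 1 - k) / ((m + 2) * (m + 1)) := by
  obtain ⟨j, rfl⟩ := Nat.exists_eq_add_of_le hk
  have hfac : ((k + j).choose k : ℝ) * k.factorial * j.factorial = (k + j).factorial := by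
    exact_mod_cast Nat.choose_symm_add ▸ Nat.add_choose_mul_factorial_mul_factorial k j
  have hne : ((k + j).factorial : ℝ) ≠ 0 := by positivity
  rw [show k + j + 2 - k - 1 = j + 1 by omega, Nat.factorial_succ j,
    Nat.factorial_succ (k + j + 1), Nat.factorial_succ (k + j)]
  push_cast
  field_simp
  linear_combination (j + 1 : ℝ) * (k + j + 2 : ℝ) * hfac

theorem sum_range_sub_cast (m : ℕ) :
    ∑ k ∈ Finset.range (m + 1), ((m : ℝ) + 1 - k) = (m + 2) * (m + 1) / 2 := by
  induction m with
  | zero => norm_num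
  | succ m ih =>
    rw [Finset.sum_range_succ']
    push_cast
    simp only [add_sub_add_right_eq_sub, ih]
    ring

/-- For the star graph `S_{n−1}` on `n ≥ 2` vertices, the Shapley influence
value of every leaf vertex equals `1/2`. -/
theorem shapley_starGraph_leaf (n : ℕ) (hn : 2 ≤ n) (v : Fin (n - 1)) :
    shapley (starGraph (n - 1)) (some v) = 1 / 2 := by
  obtain ⟨m, rfl⟩ := Nat.exists_eq_add_of_le' hn
  change Fin (m + 1) at v
  change shapley (starGraph (m + 1)) (some v) = 1 / 2
  unfold shapley
  have hcard : Fintype.card (Option (Fin (m + 1))) = m + 2 := by simp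
  rw [hcard]
  have hterm : ∀ C ∈ ((Finset.univ : Finset (Option (Fin (m + 1)))).erase (some v)).powerset,
      ((C.card.factorial : ℝ) * ((m + 2 - C.card - 1).factorial : ℝ) / ((m + 2).factorial : ℝ)) *
        |(betti (starGraph (m + 1)) (insert (some v) C) : ℝ) - (betti (starGraph (m + 1)) C : ℝ)|
      = if none ∉ C then
          (C.card.factorial : ℝ) * ((m + 2 - C.card - 1).factorial : ℝ) / ((m + 2).factorial : ℝ)
        else 0 := by
    intro C hC
    rw [abs_betti_insert_leaf_sub fun h => by simpa using Finset.mem_powerset.mp hC h,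
      mul_ite, mul_one, mul_zero]
  have hfilter : ((Finset.univ : Finset (Option (Fin (m + 1)))).erase (some v)).powerset.filter
      (fun C => none ∉ C) = ((Finset.univ.erase (some v)).erase none).powerset := by
    ext C
    simp [Finset.subset_erase]
  have hcard' : (((Finset.univ : Finset (Option (Fin (m + 1)))).erase (some v)).erase none).card
      = m := by
    simp [Finset.card_erase_of_mem]
  rw [Finset.sum_congr rfl hterm, ← Finset.sum_filter, hfilter,
    Finset.sum_powerset_apply_card (fun k => (k.factorial : ℝ) *
      ((m + 2 - k - 1).factorial : ℝ) / ((m + 2).factorial : ℝ)), hcard']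
  simp only [nsmul_eq_mul]
  rw [Finset.sum_congr rfl fun k hk =>
      choose_mul_shapley_weight (Nat.lt_succ_iff.mp (Finset.mem_range.mp hk)),
    ← Finset.sum_div, sum_range_sub_cast]
  field_simp
end

section
/- For the star graph S_{n−1} on n ≥ 2 vertices, the Shapley influence value of the center vertex equals (n² − 3n + 4)/(2n). -/
open Finset

lemma betti_eq_card_of_isIndepSet {V : Type*} {G : SimpleGraph V} {C : Finset V}
    (h : G.IsIndepSet C) : betti G C = C.card := by
  have hbot : SimpleGraph.induce (C : Set V) G = ⊥ := by
    ext a b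
    simp only [SimpleGraph.comap_adj, SimpleGraph.bot_adj, iff_false]
    exact fun hab => h a.2 b.2 hab.ne hab
  have hbij : Function.Bijective (⊥ : SimpleGraph (C : Set V)).connectedComponentMk := by
    refine ⟨fun a b hab => ?_, Quot.mk_surjective⟩
    simpa using SimpleGraph.ConnectedComponent.eq.mp hab
  rw [betti, hbot, ← Nat.card_congr (Equiv.ofBijective _ hbij)]
  simp

lemma betti_eq_one_of_forall_adj {V : Type*} {G : SimpleGraph V} {C : Finset V} {v : V}
    (hv : v ∈ C) (h : ∀ u ∈ C, v ≠ u → G.Adj v u) : betti G C = 1 := by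
  have hconn : (SimpleGraph.induce (C : Set V) G).Connected :=
    .of_isUniversal (v := ⟨v, hv⟩) fun u huv => h u u.2 fun heq => huv (Subtype.ext heq)
  exact Nat.card_eq_one_iff_unique.mpr ⟨hconn.preconnected.subsingleton_connectedComponent,
    ⟨SimpleGraph.connectedComponentMk _ ⟨v, hv⟩⟩⟩

lemma sum_range_abs_one_sub (m : ℕ) :
    ∑ k ∈ range (m + 1 + 1), |1 - (k : ℝ)| = 1 + ((m : ℝ) + 1) * m / 2 := by
  induction m with
  | zero => simp [sum_range_succ]
  | succ m ih =>
    rw [sum_range_succ, ih, abs_of_nonpos (by push_cast; linarith [m.cast_nonneg (α := ℝ)])]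
    push_cast
    ring

/-- For the star graph `S_{n−1}` on `n ≥ 2` vertices, the Shapley influence
value of the center vertex equals `(n² − 3n + 4)/(2n)`. -/
theorem shapley_starGraph_center (n : ℕ) (hn : 2 ≤ n) :
    shapley (starGraph (n - 1)) none = ((n : ℝ) ^ 2 - 3 * (n : ℝ) + 4) / (2 * (n : ℝ)) := by
  obtain ⟨m, rfl⟩ : ∃ m, n = m + 1 + 1 := ⟨n - 2, by omega⟩
  rw [Nat.add_sub_cancel]
  let f : ℕ → ℝ := fun k =>
    (k.factorial * ((m + 1 + 1 - k - 1).factorial : ℝ) / (m + 1 + 1).factorial) * |1 - (k : ℝ)|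
  have hbetti : shapley (starGraph (m + 1)) none =
      ∑ C ∈ ((univ : Finset (Option (Fin (m + 1)))).erase none).powerset, f C.card := by
    refine sum_congr rfl fun C hC => ?_
    have hnone : none ∉ C := fun hmem => by simpa using mem_powerset.mp hC hmem
    rw [betti_eq_one_of_forall_adj (G := starGraph (m + 1)) (mem_insert_self none C)
        fun u _ hu => ⟨hu, Or.inl rfl⟩,
      betti_eq_card_of_isIndepSet (G := starGraph (m + 1)) fun a ha b hb _ hab => hab.2.elim
        (fun h => hnone (h ▸ ha)) (fun h => hnone (h ▸ hb))]
    simp [f]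
  have hterm : ∀ k ∈ range (m + 1 + 1),
      (m + 1).choose k • f k = |1 - (k : ℝ)| / ((m : ℝ) + 2) := by
    intro k hk
    have hchoose : ((m + 1).choose k : ℝ) * k.factorial * (m + 1 - k).factorial =
        (m + 1).factorial := by
      exact_mod_cast Nat.choose_mul_factorial_mul_factorial (Nat.lt_succ_iff.mp (mem_range.mp hk))
    have hsub : m + 1 + 1 - k - 1 = m + 1 - k := by omega
    have hsucc : ((m + 1 + 1).factorial : ℝ) = ((m : ℝ) + 2) * (m + 1).factorial := by
      rw [Nat.factorial_succ (m + 1)]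
      push_cast
      ring
    simp only [f, hsub, nsmul_eq_mul]
    rw [hsucc, ← hchoose]
    have hpos : ((m + 1).choose k : ℝ) ≠ 0 :=
      Nat.cast_ne_zero.mpr (Nat.choose_pos (Nat.lt_succ_iff.mp (mem_range.mp hk))).ne'
    field_simp
  have hcard : ((univ : Finset (Option (Fin (m + 1)))).erase none).card = m + 1 := by simp
  rw [hbetti, sum_powerset_apply_card, hcard, sum_congr rfl hterm, ← sum_div,
    sum_range_abs_one_sub]
  push_cast
  field_simp
  ring
end

section
/- For the path graph P_n on n ≥ 2 vertices, the Shapley influence value of each of the two endpoint vertices equals 1/2. -/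
open Finset

/-- The path graph on `Fin n`: `i` adjacent to `j` iff `|i − j| = 1`. -/
def pathGraph (n : ℕ) : SimpleGraph (Fin n) :=
  SimpleGraph.fromRel (fun i j => i.val + 1 = j.val)

/-- A function on vertices that is constant along edges is constant on connected components. -/
theorem SimpleGraph.Walk.apply_eq_of_forall_adj {V α : Type*} {G : SimpleGraph V} {f : V → α}
    (hf : ∀ a b, G.Adj a b → f a = f b) {a b : V} (p : G.Walk a b) : f a = f b := by
  induction p with
  | nil => rfl
  | cons h _ ih => exact (hf _ _ h).trans ih

/-- Adding a pendant vertex next to its neighbor does not change the number of components. -/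
theorem betti_insert_of_neighbor_mem {V : Type*} [DecidableEq V] {G : SimpleGraph V} {u v : V}
    (hG : ∀ w, G.Adj v w ↔ w = u) {C : Finset V} (hu : u ∈ C) :
    betti G (insert v C) = betti G C := by
  have hsub : (C : Set V) ≤ ((insert v C : Finset V) : Set V) := by
    intro x hx
    exact Finset.mem_coe.2 (Finset.mem_insert_of_mem hx)
  let f : ((insert v C : Finset V) : Set V) →
      (SimpleGraph.induce (↑C : Set V) G).ConnectedComponent := fun x =>
    if h : x.1 ∈ C then SimpleGraph.connectedComponentMk _ ⟨x.1, h⟩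
    else SimpleGraph.connectedComponentMk _ ⟨u, hu⟩
  have hmem : ∀ x : ((insert v C : Finset V) : Set V), x.1 ∉ C → x.1 = v := fun x hx =>
    (Finset.mem_insert.1 (Finset.mem_coe.1 x.2)).resolve_right hx
  have hf : ∀ a b, (SimpleGraph.induce ((insert v C : Finset V) : Set V) G).Adj a b →
      f a = f b := by
    intro a b hab
    have hab' : G.Adj a.1 b.1 := hab
    by_cases ha : a.1 ∈ C <;> by_cases hb : b.1 ∈ C
    · simp only [f, ha, hb, dite_true]
      exact SimpleGraph.ConnectedComponent.sound (SimpleGraph.Adj.reachable hab')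
    · rw [hmem b hb] at hab'
      have := (hG _).1 hab'.symm
      simp [f, this, hu, hb]
    · rw [hmem a ha] at hab'
      have := (hG _).1 hab'
      simp [f, this, hu, ha]
    · simp only [f, ha, hb, dite_false]
  refine Nat.card_congr
    { toFun := SimpleGraph.ConnectedComponent.lift f
        fun a b p _ => p.apply_eq_of_forall_adj hf
      invFun := SimpleGraph.ConnectedComponent.map (SimpleGraph.induceHomOfLE G hsub).toHom
      left_inv := ?_
      right_inv := ?_ }
  · refine SimpleGraph.ConnectedComponent.ind fun x => ?_
    by_cases hx : x.1 ∈ C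
    · simp only [SimpleGraph.ConnectedComponent.lift_mk, f, hx, dite_true]
      rfl
    · simp only [SimpleGraph.ConnectedComponent.lift_mk, f, hx, dite_false]
      refine SimpleGraph.ConnectedComponent.sound (SimpleGraph.Adj.reachable ?_)
      change G.Adj u x.1
      rw [hmem x hx]
      exact ((hG u).2 rfl).symm
  · refine SimpleGraph.ConnectedComponent.ind fun x => ?_
    have hx : x.1 ∈ C := x.2
    change f ⟨x.1, hsub x.2⟩ = _
    simp only [f, hx, dite_true]

/-- Adding a vertex with no neighbor in `C` creates exactly one new component. -/
theorem betti_insert_of_forall_not_adj {V : Type*} [DecidableEq V] {G : SimpleGraph V} {v : V}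
    {C : Finset V} (hG : ∀ w ∈ C, ¬ G.Adj v w) (hv : v ∉ C) :
    betti G (insert v C) = betti G C + 1 := by
  have hsub : (C : Set V) ≤ ((insert v C : Finset V) : Set V) := by
    intro x hx
    exact Finset.mem_coe.2 (Finset.mem_insert_of_mem hx)
  let f : ((insert v C : Finset V) : Set V) →
      Option (SimpleGraph.induce (↑C : Set V) G).ConnectedComponent := fun x =>
    if h : x.1 ∈ C then some (SimpleGraph.connectedComponentMk _ ⟨x.1, h⟩) else none
  have hmem : ∀ x : ((insert v C : Finset V) : Set V), x.1 ∉ C → x.1 = v := fun x hx =>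
    (Finset.mem_insert.1 (Finset.mem_coe.1 x.2)).resolve_right hx
  have hf : ∀ a b, (SimpleGraph.induce ((insert v C : Finset V) : Set V) G).Adj a b →
      f a = f b := by
    intro a b hab
    have hab' : G.Adj a.1 b.1 := hab
    by_cases ha : a.1 ∈ C <;> by_cases hb : b.1 ∈ C
    · simp only [f, ha, hb, dite_true]
      exact congrArg some
        (SimpleGraph.ConnectedComponent.sound (SimpleGraph.Adj.reachable hab'))
    · rw [hmem b hb] at hab'
      exact absurd hab'.symm (hG _ ha)
    · rw [hmem a ha] at hab'
      exact absurd hab' (hG _ hb)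
    · simp only [f, ha, hb, dite_false]
  have : Finite (SimpleGraph.induce (↑C : Set V) G).ConnectedComponent := Quot.finite _
  rw [betti, betti, ← Finite.card_option]
  refine Nat.card_congr
    { toFun := SimpleGraph.ConnectedComponent.lift f
        fun a b p _ => p.apply_eq_of_forall_adj hf
      invFun := fun o => o.elim
        (SimpleGraph.connectedComponentMk _
          ⟨v, Finset.mem_coe.2 (Finset.mem_insert_self v C)⟩)
        (SimpleGraph.ConnectedComponent.map (SimpleGraph.induceHomOfLE G hsub).toHom)
      left_inv := ?_
      right_inv := ?_ }
  · refine SimpleGraph.ConnectedComponent.ind fun x => ?_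
    by_cases hx : x.1 ∈ C
    · simp only [SimpleGraph.ConnectedComponent.lift_mk, f, hx, dite_true]
      rfl
    · simp only [SimpleGraph.ConnectedComponent.lift_mk, f, hx, dite_false, Option.elim_none]
      exact congrArg _ (Subtype.ext (hmem x hx).symm)
  · rintro (_ | c)
    · change f ⟨v, _⟩ = none
      simp only [f, hv, dite_false]
    · induction c using SimpleGraph.ConnectedComponent.ind with | _ x
      have hx : x.1 ∈ C := x.2
      change f ⟨x.1, hsub x.2⟩ = _
      simp only [f, hx, dite_true]

/-- The total Shapley weight of the coalitions inside a fixed set of `m` among `m + 2` players. -/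
theorem sum_range_shapley_weights (m : ℕ) :
    ∑ k ∈ Finset.range (m + 1), (m.choose k : ℝ) *
      ((k.factorial : ℝ) * ((m + 2 - k - 1).factorial : ℝ) / ((m + 2).factorial : ℝ)) = 1 / 2 := by
  have hterm : ∀ k ∈ Finset.range (m + 1), (m.choose k : ℝ) *
      ((k.factorial : ℝ) * ((m + 2 - k - 1).factorial : ℝ) / ((m + 2).factorial : ℝ)) =
      ((m + 1 - k : ℕ) : ℝ) / (((m : ℝ) + 2) * (m + 1)) := by
    intro k hk
    have hk' : k ≤ m := Nat.lt_succ_iff.1 (Finset.mem_range.1 hk)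
    have h1 : m + 2 - k - 1 = (m - k) + 1 := by omega
    have h2 : m + 1 - k = (m - k) + 1 := by omega
    have h3 : (m.choose k : ℝ) * k.factorial * (m - k).factorial = m.factorial := by
      exact_mod_cast Nat.choose_mul_factorial_mul_factorial hk'
    have h4 : (m.factorial : ℝ) ≠ 0 := by positivity
    rw [h1, h2, Nat.factorial_succ, Nat.factorial_succ (m + 1), Nat.factorial_succ m]
    push_cast
    rw [← mul_div_assoc, div_eq_div_iff (by positivity) (by positivity), ← h3]
    ring
  have hsum : ∑ k ∈ Finset.range (m + 1), ((m + 1 - k : ℕ) : ℝ) =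
      ((m : ℝ) + 2) * (m + 1) / 2 := by
    clear hterm
    induction m with
    | zero => simp
    | succ m ih =>
      rw [Finset.sum_range_succ']
      simp only [Nat.add_sub_add_right, Nat.sub_zero]
      rw [ih]
      push_cast
      ring
  rw [Finset.sum_congr rfl hterm, ← Finset.sum_div, hsum]
  field_simp

/-- A vertex with exactly one neighbor has Shapley influence value `1/2`. -/
theorem shapley_eq_half_of_unique_neighbor {V : Type*} [Fintype V] [DecidableEq V]
    {G : SimpleGraph V} {u v : V} (hG : ∀ w, G.Adj v w ↔ w = u) : shapley G v = 1 / 2 := by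
  have huv : u ≠ v := ((hG u).2 rfl).ne'
  obtain ⟨m, hm⟩ : ∃ m, Fintype.card V = m + 2 := by
    have : 1 < Fintype.card V := Fintype.one_lt_card_iff.2 ⟨u, v, huv⟩
    exact ⟨Fintype.card V - 2, by omega⟩
  have hcard : ((Finset.univ.erase v).erase u).card = m := by
    rw [Finset.card_erase_of_mem (by simp [huv]), Finset.card_erase_of_mem (Finset.mem_univ v),
      Finset.card_univ, hm]
    omega
  have hsub : ((Finset.univ.erase v).erase u).powerset ⊆ (Finset.univ.erase v).powerset :=
    Finset.powerset_mono.2 (Finset.erase_subset _ _)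
  have hnot : ∀ C ∈ (Finset.univ.erase v).powerset, v ∉ C := fun C hC h =>
    Finset.notMem_erase v _ (Finset.mem_powerset.1 hC h)
  rw [shapley, ← Finset.sum_subset hsub, hm]
  · rw [← sum_range_shapley_weights m, ← hcard]
    have := Finset.sum_powerset_apply_card
      (fun k => (k.factorial : ℝ) * ((m + 2 - k - 1).factorial : ℝ) / ((m + 2).factorial : ℝ))
      (x := (Finset.univ.erase v).erase u)
    simp only [nsmul_eq_mul, hcard] at this ⊢
    rw [← this]
    refine Finset.sum_congr rfl fun C hC => ?_
    have hu : u ∉ C := fun h => Finset.notMem_erase u _ (Finset.mem_powerset.1 hC h)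
    rw [betti_insert_of_forall_not_adj
      (fun w hw h => hu ((hG w).1 h ▸ hw)) (hnot C (hsub hC))]
    simp
  · intro C hC hC'
    have hu : u ∈ C := by
      by_contra hu
      exact hC' (Finset.mem_powerset.2
        (Finset.subset_erase.2 ⟨Finset.mem_powerset.1 hC, hu⟩))
    rw [betti_insert_of_neighbor_mem hG hu]
    simp

/-- For the path graph `P_n` on `n ≥ 2` vertices, the Shapley influence value
of each of the two endpoint vertices equals `1/2`. -/
theorem shapley_pathGraph_endpoint (n : ℕ) (hn : 2 ≤ n) (v : Fin n)
    (hv : v.val = 0 ∨ v.val = n - 1) :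
    shapley (pathGraph n) v = 1 / 2 := by
  rcases hv with hv | hv
  · refine shapley_eq_half_of_unique_neighbor (u := ⟨1, by omega⟩) fun w => ?_
    simp only [pathGraph, SimpleGraph.fromRel_adj, Fin.ext_iff, ne_eq]
    omega
  · refine shapley_eq_half_of_unique_neighbor (u := ⟨n - 2, by omega⟩) fun w => ?_
    simp only [pathGraph, SimpleGraph.fromRel_adj, Fin.ext_iff, ne_eq]
    omega
end

section
/- For the path graph P_n on n ≥ 3 vertices, the Shapley influence value of every interior (non-endpoint) vertex equals 2/3. -/
open Finset

/-- The Shapley weight of a coalition of size `a` with `b` vertices outside it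
(not counting the vertex being scored). -/
noncomputable def shapleyWeight (a b : ℕ) : ℝ :=
  (a.factorial : ℝ) * (b.factorial : ℝ) / ((a + b + 1).factorial : ℝ)

theorem shapleyWeight_succ_add_succ (a b : ℕ) :
    shapleyWeight a (b + 1) + shapleyWeight (a + 1) b = shapleyWeight a b := by
  have h : ((a + b + 1).factorial : ℝ) ≠ 0 := by positivity
  have h' : (a : ℝ) + b + 1 + 1 ≠ 0 := by positivity
  simp only [shapleyWeight, show a + (b + 1) + 1 = (a + b + 1) + 1 by ring,
    show a + 1 + b + 1 = (a + b + 1) + 1 by ring, Nat.factorial_succ (a + b + 1),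
    Nat.factorial_succ a, Nat.factorial_succ b]
  push_cast
  field_simp
  ring

theorem sum_powerset_shapleyWeight {α : Type*} [DecidableEq α] (S : Finset α) (a b : ℕ) :
    ∑ C ∈ S.powerset, shapleyWeight (a + #C) (b + (#S - #C)) = shapleyWeight a b := by
  induction S using Finset.induction_on generalizing a b with
  | empty => simp
  | insert u S hu ih =>
    rw [Finset.sum_powerset_insert hu, ← shapleyWeight_succ_add_succ, ← ih a (b + 1),
      ← ih (a + 1) b]
    congr 1 <;> refine Finset.sum_congr rfl fun C hC => ?_
    all_goals
      rw [Finset.mem_powerset] at hC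
      have hcard := Finset.card_le_card hC
      have huC : u ∉ C := fun h => hu (hC h)
      simp only [Finset.card_insert_of_notMem hu, Finset.card_insert_of_notMem huC]
      congr 1 <;> omega

/-- The elements of `C` whose successor is not in `C`. -/
def runEnds {n : ℕ} (C : Finset (Fin n)) : Finset (Fin n) :=
  {i ∈ C | ∀ j ∈ C, j.val ≠ i.val + 1}

theorem mem_runEnds {n : ℕ} {C : Finset (Fin n)} {i : Fin n} :
    i ∈ runEnds C ↔ i ∈ C ∧ ∀ j ∈ C, j.val ≠ i.val + 1 := by
  simp [runEnds]

theorem pathGraph_adj_iff {n : ℕ} {i j : Fin n} :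
    (pathGraph n).Adj i j ↔ i.val + 1 = j.val ∨ j.val + 1 = i.val := by
  simp only [pathGraph, SimpleGraph.fromRel_adj, ne_eq, Fin.ext_iff]
  omega

theorem le_of_reachable_runEnd {n : ℕ} {C : Finset (Fin n)} {x y : (C : Set (Fin n))}
    (hx : x.1 ∈ runEnds C)
    (h : ((pathGraph n).induce (C : Set (Fin n))).Reachable x y) : y.1 ≤ x.1 := by
  rw [SimpleGraph.reachable_iff_reflTransGen] at h
  induction h with
  | refl => exact le_rfl
  | @tail b c _ hbc ih =>
    rw [SimpleGraph.induce_adj, pathGraph_adj_iff] at hbc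
    have := (mem_runEnds.1 hx).2 c.1 c.2
    rw [Fin.le_def] at ih ⊢
    omega

theorem exists_reachable_runEnd {n : ℕ} {C : Finset (Fin n)} (x : (C : Set (Fin n))) :
    ∃ y : (C : Set (Fin n)), y.1 ∈ runEnds C ∧
      ((pathGraph n).induce (C : Set (Fin n))).Reachable y x := by
  induction h : n - x.1.val using Nat.strong_induction_on generalizing x with
  | _ k ih =>
    by_cases hx : x.1 ∈ runEnds C
    · exact ⟨x, hx, .rfl⟩
    · obtain ⟨j, hj, hjx⟩ : ∃ j ∈ C, j.val = x.1.val + 1 := by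
        simpa [mem_runEnds, show x.1 ∈ C from x.2] using hx
      obtain ⟨y, hy, hyj⟩ := ih (n - j.val) (by omega) ⟨j, hj⟩ rfl
      refine ⟨y, hy, hyj.trans (SimpleGraph.Adj.reachable ?_)⟩
      rw [SimpleGraph.induce_adj, pathGraph_adj_iff]
      exact Or.inr hjx.symm

theorem betti_pathGraph {n : ℕ} (C : Finset (Fin n)) :
    betti (pathGraph n) C = #(runEnds C) := by
  let f : runEnds C → ((pathGraph n).induce (C : Set (Fin n))).ConnectedComponent :=
    fun i => SimpleGraph.connectedComponentMk _ ⟨i.1, (mem_runEnds.1 i.2).1⟩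
  have hf : Function.Bijective f := by
    constructor
    · intro i j hij
      have h := SimpleGraph.ConnectedComponent.exact hij
      exact Subtype.ext (le_antisymm (le_of_reachable_runEnd (C := C) j.2 h.symm)
        (le_of_reachable_runEnd (C := C) i.2 h))
    · intro c
      induction c using SimpleGraph.ConnectedComponent.ind with
      | _ x =>
        obtain ⟨y, hy, h⟩ := exists_reachable_runEnd x
        exact ⟨⟨y.1, hy⟩, SimpleGraph.ConnectedComponent.sound h⟩
  rw [betti, ← Nat.card_eq_of_bijective f hf, Nat.card_eq_fintype_card, Fintype.card_coe]

/-- Adding a vertex `v` with neighbours `a` and `b` to `C` changes the number of components by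
`1 - |C ∩ {a, b}|`. -/
theorem betti_pathGraph_insert {n : ℕ} {C : Finset (Fin n)} {a v b : Fin n} (hv : v ∉ C)
    (hav : a.val + 1 = v.val) (hvb : v.val + 1 = b.val) :
    betti (pathGraph n) (insert v C) + (if a ∈ C then 1 else 0) + (if b ∈ C then 1 else 0) =
      betti (pathGraph n) C + 1 := by
  simp only [betti_pathGraph]
  have hvT : v ∉ runEnds C := fun h => hv (mem_runEnds.1 h).1
  have hmem (i : Fin n) : i ∈ runEnds (insert v C) ↔
      (i = v ∧ b ∉ C) ∨ (i ∈ runEnds C ∧ i ≠ a) := by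
    simp only [mem_runEnds, Finset.mem_insert, Fin.ext_iff]
    grind
  have haT : a ∈ C → a ∈ runEnds C := fun ha =>
    mem_runEnds.2 ⟨ha, fun j hj hja => hv (by rwa [← Fin.ext (hja.trans hav)])⟩
  have haT' : a ∉ C → a ∉ runEnds C := fun ha h => ha (mem_runEnds.1 h).1
  have hT : runEnds (insert v C) =
      if b ∈ C then (runEnds C).erase a else insert v ((runEnds C).erase a) := by
    ext i
    rw [hmem]
    split_ifs <;> simp [*, and_comm]
  have herase : #((runEnds C).erase a) + (if a ∈ C then 1 else 0) = #(runEnds C) := by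
    split_ifs with ha
    · exact Finset.card_erase_add_one (haT ha)
    · rw [Finset.erase_eq_of_notMem (haT' ha), add_zero]
  have hvE : v ∉ (runEnds C).erase a := fun h => hvT (Finset.mem_of_mem_erase h)
  rw [hT, ← herase]
  by_cases hb : b ∈ C
  · simp [hb]
  · simp only [hb, if_false, Finset.card_insert_of_notMem hvE]
    ring

/-- For the path graph `P_n` on `n ≥ 3` vertices, the Shapley influence value
of every interior (non-endpoint) vertex equals `2/3`. -/
theorem shapley_pathGraph_interior (n : ℕ) (hn : 3 ≤ n) (v : Fin n)
    (hv : 0 < v.val ∧ v.val < n - 1) :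
    shapley (pathGraph n) v = 2 / 3 := by
  obtain ⟨hv0, hv1⟩ := hv
  let a : Fin n := ⟨v.val - 1, by omega⟩
  let b : Fin n := ⟨v.val + 1, by omega⟩
  have hav : a.val + 1 = v.val := Nat.sub_add_cancel hv0
  have hvb : v.val + 1 = b.val := rfl
  have hva : v ≠ a := by rw [ne_eq, Fin.ext_iff]; omega
  have hvb' : v ≠ b := by rw [ne_eq, Fin.ext_iff]; omega
  have hab : a ≠ b := by rw [ne_eq, Fin.ext_iff]; omega
  let S : Finset (Fin n) := ((univ.erase v).erase a).erase b
  have hbS : b ∉ S := Finset.notMem_erase _ _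
  have haS : a ∉ insert b S := by simp [S, hab]
  have hb : b ∈ (univ.erase v).erase a := by simp [hab.symm, hvb'.symm]
  have ha : a ∈ univ.erase v := by simp [hva.symm]
  have hS : univ.erase v = insert a (insert b S) := by
    rw [Finset.insert_erase hb, Finset.insert_erase ha]
  have hcard : n = #S + 3 := by
    have := Finset.card_erase_add_one (Finset.mem_univ v)
    rw [hS, Finset.card_insert_of_notMem haS, Finset.card_insert_of_notMem hbS,
      Finset.card_univ, Fintype.card_fin] at this
    omega
  have hterm : ∀ C ∈ (univ.erase v).powerset,
      ((#C).factorial : ℝ) * ((Fintype.card (Fin n) - #C - 1).factorial : ℝ)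
          / ((Fintype.card (Fin n)).factorial : ℝ) *
        |(betti (pathGraph n) (insert v C) : ℝ) - (betti (pathGraph n) C : ℝ)| =
      if a ∈ C ↔ b ∈ C then shapleyWeight (#C) (n - 1 - #C) else 0 := by
    intro C hC
    rw [Finset.mem_powerset] at hC
    have hvC : v ∉ C := fun h => Finset.notMem_erase v univ (hC h)
    have hCn : #C ≤ n - 1 := by
      simpa [Finset.card_erase_of_mem] using Finset.card_le_card hC
    have hβ := congrArg (Nat.cast : ℕ → ℝ) (betti_pathGraph_insert hvC hav hvb)
    push_cast at hβ
    have hdiff : |(betti (pathGraph n) (insert v C) : ℝ) - (betti (pathGraph n) C : ℝ)| =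
        if a ∈ C ↔ b ∈ C then 1 else 0 := by
      rw [show (betti (pathGraph n) (insert v C) : ℝ) - (betti (pathGraph n) C : ℝ) =
        1 - (if a ∈ C then 1 else 0) - (if b ∈ C then 1 else 0) by linarith]
      by_cases h₁ : a ∈ C <;> by_cases h₂ : b ∈ C <;> simp [h₁, h₂]
    rw [hdiff, mul_ite, mul_one, mul_zero, shapleyWeight, Fintype.card_fin,
      show #C + (n - 1 - #C) + 1 = n by omega, show n - #C - 1 = n - 1 - #C by omega]
  rw [shapley, Finset.sum_congr rfl hterm, hS, Finset.sum_powerset_insert haS,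
    Finset.sum_powerset_insert hbS, Finset.sum_powerset_insert hbS,
    ← Finset.sum_add_distrib, ← Finset.sum_add_distrib, ← Finset.sum_add_distrib]
  trans ∑ C ∈ S.powerset,
    (shapleyWeight (0 + #C) (2 + (#S - #C)) + shapleyWeight (2 + #C) (0 + (#S - #C)))
  · refine Finset.sum_congr rfl fun C hC => ?_
    rw [Finset.mem_powerset] at hC
    have hCS := Finset.card_le_card hC
    have hbC : b ∉ C := fun h => hbS (hC h)
    have haC : a ∉ C := fun h => haS (Finset.mem_insert_of_mem (hC h))
    have haC' : a ∉ insert b C := by simp [hab, haC]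
    simp only [Finset.mem_insert, haC, hbC, hab, hab.symm, Finset.card_insert_of_notMem haC',
      Finset.card_insert_of_notMem hbC, or_false, or_true, iff_true, iff_false,
      not_true_eq_false, if_true, if_false, add_zero, zero_add]
    congr 2 <;> omega
  · rw [Finset.sum_add_distrib, sum_powerset_shapleyWeight, sum_powerset_shapleyWeight]
    norm_num [shapleyWeight, Nat.factorial]
end

section
/- For the complete bipartite graph K_{m,n} with m, n ≥ 1, the Shapley influence value of every vertex on the side of size m equals n(n−1)/(m(m+1)(m+n)) + 1/(n+1). -/
open Finset

open SimpleGraph in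
theorem betti_eq_card {V : Type*} {G : SimpleGraph V} {C : Finset V}
    (h : ∀ x ∈ C, ∀ y ∈ C, ¬ G.Adj x y) : betti G C = #C := by
  have hbot : SimpleGraph.induce (↑C : Set V) G = ⊥ := by
    ext x y
    simpa using h x x.2 y y.2
  have hbij : Function.Bijective
      (SimpleGraph.induce (↑C : Set V) G).connectedComponentMk := by
    refine ⟨fun x y hxy => ?_, fun c => c.exists_rep⟩
    have hr := ConnectedComponent.exact hxy
    rw [hbot] at hr
    exact reachable_bot.1 hr
  rw [betti, ← Nat.card_eq_of_bijective _ hbij]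
  simp

open SimpleGraph in
theorem betti_completeBipartiteGraph_eq_one {V W : Type*} {C : Finset (V ⊕ W)} {a : V} {b : W}
    (ha : Sum.inl a ∈ C) (hb : Sum.inr b ∈ C) : betti (completeBipartiteGraph V W) C = 1 := by
  set H := SimpleGraph.induce (↑C : Set (V ⊕ W)) (completeBipartiteGraph V W) with hH
  have hab : H.Adj ⟨_, ha⟩ ⟨_, hb⟩ := by simp [hH]
  have hreach : ∀ x, H.Reachable x ⟨_, ha⟩ := by
    rintro ⟨x | x, hx⟩
    · have hxb : H.Adj ⟨_, hx⟩ ⟨_, hb⟩ := by simp [hH]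
      exact hxb.reachable.trans hab.symm.reachable
    · have hxa : H.Adj ⟨_, hx⟩ ⟨_, ha⟩ := by simp [hH]
      exact hxa.reachable
  have hpre : H.Preconnected := fun x y => (hreach x).trans (hreach y).symm
  have : Subsingleton H.ConnectedComponent := hpre.subsingleton_connectedComponent
  have : Nonempty H.ConnectedComponent := ⟨H.connectedComponentMk ⟨_, ha⟩⟩
  exact Nat.card_eq_one_iff_unique.2 ⟨inferInstance, inferInstance⟩

theorem abs_betti_insert_sub_betti {V W : Type*} [Fintype V] [Fintype W] [DecidableEq V]
    [DecidableEq W] {v : V} {C : Finset (V ⊕ W)} (hv : Sum.inl v ∉ C) :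
    |(betti (completeBipartiteGraph V W) (insert (Sum.inl v) C) : ℝ)
        - (betti (completeBipartiteGraph V W) C : ℝ)| =
      (if C ⊆ (univ.erase v).map .inl then 1 else 0) +
        (if C ⊆ univ.map .inr then (#C : ℝ) - 1 else 0) + (if C ⊆ ∅ then 1 else 0) := by
  rcases C.eq_empty_or_nonempty with rfl | hC
  · rw [betti_eq_card (by simp), betti_eq_card (by simp)]
    simp
  have hne : ¬ C ⊆ ∅ := by simpa [Finset.subset_empty] using hC.ne_empty
  by_cases hr : ∃ b, Sum.inr b ∈ C
  · obtain ⟨b, hb⟩ := hr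
    have hL : ¬ C ⊆ (univ.erase v).map .inl := fun h => by simpa using h hb
    rw [betti_completeBipartiteGraph_eq_one (mem_insert_self _ _) (mem_insert_of_mem hb)]
    by_cases hl : ∃ a, Sum.inl a ∈ C
    · obtain ⟨a, ha⟩ := hl
      have hR : ¬ C ⊆ univ.map .inr := fun h => by simpa using h ha
      rw [betti_completeBipartiteGraph_eq_one ha hb]
      rw [if_neg hL, if_neg hR, if_neg hne]
      simp
    · push Not at hl
      have hR : C ⊆ univ.map .inr := by
        rintro (x | x) hx
        · exact absurd hx (hl x)
        · simp
      rw [betti_eq_card]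
      · have : (1 : ℝ) ≤ #C := by exact_mod_cast hC.card_pos
        rw [if_neg hL, if_pos hR, if_neg hne, abs_sub_comm, Nat.cast_one,
          abs_of_nonneg (by linarith)]
        ring
      · rintro (x | x) hx (y | y) hy <;> simp_all
  · push Not at hr
    have hL : C ⊆ (univ.erase v).map .inl := by
      rintro (x | x) hx
      · have : x ≠ v := by rintro rfl; exact hv hx
        simpa using this
      · exact absurd hx (hr x)
    have hR : ¬ C ⊆ univ.map .inr := by
      obtain ⟨x | x, hx⟩ := hC
      · exact fun h => by simpa using h hx
      · exact absurd hx (hr x)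
    rw [betti_eq_card, betti_eq_card, card_insert_of_notMem hv]
    · rw [if_pos hL, if_neg hR, if_neg hne]
      simp
    · rintro (x | x) hx (y | y) hy <;> simp_all
    · rintro (x | x) hx (y | y) hy <;> simp_all

theorem sum_descFactorial_mul_factorial (n p : ℕ) :
    ∑ k ∈ range (n + 1), (n.descFactorial k : ℝ) * (n + p - k).factorial =
      (n + p + 1).factorial / (p + 1) := by
  induction n with
  | zero =>
    have : (p : ℝ) + 1 ≠ 0 := by positivity
    simp [Nat.factorial_succ]
    field_simp
  | succ n ih =>
    have hstep : ∀ k ∈ range (n + 1),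
        ((n + 1).descFactorial (k + 1) : ℝ) * (n + 1 + p - (k + 1)).factorial =
          (n + 1) * ((n.descFactorial k : ℝ) * (n + p - k).factorial) := fun k _ => by
      rw [Nat.succ_descFactorial_succ, show n + 1 + p - (k + 1) = n + p - k by omega]
      push_cast
      ring
    rw [sum_range_succ', sum_congr rfl hstep, ← mul_sum, ih,
      show n + 1 + p + 1 = n + p + 1 + 1 by ring, Nat.factorial_succ (n + p + 1),
      show n + 1 + p - 0 = n + p + 1 by omega]
    have : (p : ℝ) + 1 ≠ 0 := by positivity
    push_cast [Nat.descFactorial_zero]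
    field_simp
    ring

theorem sum_mul_descFactorial_mul_factorial (n p : ℕ) :
    ∑ k ∈ range (n + 1), (k : ℝ) * ((n.descFactorial k : ℝ) * (n + p - k).factorial) =
      (n + p + 1).factorial * n / ((p + 1) * (p + 2)) := by
  induction n with
  | zero => simp
  | succ n ih =>
    have hstep : ∀ k ∈ range (n + 1), ((k + 1 : ℕ) : ℝ) *
        (((n + 1).descFactorial (k + 1) : ℝ) * (n + 1 + p - (k + 1)).factorial) =
          (n + 1) * ((k : ℝ) * ((n.descFactorial k : ℝ) * (n + p - k).factorial)) +
          (n + 1) * ((n.descFactorial k : ℝ) * (n + p - k).factorial) := fun k _ => by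
      rw [Nat.succ_descFactorial_succ, show n + 1 + p - (k + 1) = n + p - k by omega]
      push_cast
      ring
    rw [sum_range_succ', sum_congr rfl hstep, sum_add_distrib, ← mul_sum, ← mul_sum, ih,
      sum_descFactorial_mul_factorial,
      show n + 1 + p + 1 = n + p + 1 + 1 by ring, Nat.factorial_succ (n + p + 1)]
    have : (p : ℝ) + 1 ≠ 0 := by positivity
    have : (p : ℝ) + 2 ≠ 0 := by positivity
    push_cast
    field_simp
    ring

/-- The probability that, in a uniformly random order of `#x + p + 1` elements, a given element
outside `x` comes before the `p` other elements outside `x`. -/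
theorem sum_powerset_shapley_weight {α : Type*} (x : Finset α) (p : ℕ) :
    ∑ C ∈ x.powerset, ((#C).factorial : ℝ) * ((#x + p + 1 - #C - 1).factorial : ℝ)
        / ((#x + p + 1).factorial : ℝ) = 1 / (p + 1) := by
  rw [sum_powerset_apply_card (fun c => (c.factorial : ℝ) *
    ((#x + p + 1 - c - 1).factorial : ℝ) / ((#x + p + 1).factorial : ℝ))]
  have hstep : ∀ k ∈ range (#x + 1), (#x).choose k • ((k.factorial : ℝ) *
      ((#x + p + 1 - k - 1).factorial : ℝ) / ((#x + p + 1).factorial : ℝ)) =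
      ((#x).descFactorial k : ℝ) * (#x + p - k).factorial / (#x + p + 1).factorial :=
    fun k _ => by
      rw [Nat.descFactorial_eq_factorial_mul_choose,
        show #x + p + 1 - k - 1 = #x + p - k by omega, nsmul_eq_mul]
      push_cast
      ring
  rw [sum_congr rfl hstep, ← sum_div, sum_descFactorial_mul_factorial]
  field_simp

theorem sum_powerset_shapley_weight_mul_card {α : Type*} (x : Finset α) (p : ℕ) :
    ∑ C ∈ x.powerset, ((#C).factorial : ℝ) * ((#x + p + 1 - #C - 1).factorial : ℝ)
        / ((#x + p + 1).factorial : ℝ) * #C = #x / ((p + 1) * (p + 2)) := by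
  rw [sum_powerset_apply_card (fun c => (c.factorial : ℝ) *
    ((#x + p + 1 - c - 1).factorial : ℝ) / ((#x + p + 1).factorial : ℝ) * c)]
  have hstep : ∀ k ∈ range (#x + 1), (#x).choose k • ((k.factorial : ℝ) *
      ((#x + p + 1 - k - 1).factorial : ℝ) / ((#x + p + 1).factorial : ℝ) * k) =
      k * (((#x).descFactorial k : ℝ) * (#x + p - k).factorial) / (#x + p + 1).factorial :=
    fun k _ => by
      rw [Nat.descFactorial_eq_factorial_mul_choose,
        show #x + p + 1 - k - 1 = #x + p - k by omega, nsmul_eq_mul]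
      push_cast
      ring
  rw [sum_congr rfl hstep, ← sum_div, sum_mul_descFactorial_mul_factorial]
  field_simp

theorem sum_powerset_mul_ite_subset {α : Type*} [DecidableEq α] {s t : Finset α} (h : s ⊆ t)
    (f g : Finset α → ℝ) :
    ∑ C ∈ t.powerset, f C * (if C ⊆ s then g C else 0) = ∑ C ∈ s.powerset, f C * g C := by
  have hs : s.powerset = t.powerset.filter (· ⊆ s) := by
    ext C
    simpa using fun hC : C ⊆ s => hC.trans h
  rw [hs, sum_filter]
  exact sum_congr rfl fun C _ => by split_ifs <;> simp

/-- For the complete bipartite graph `K_{m,n}` with `m, n ≥ 1`, the Shapley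
influence value of every vertex on the side of size `m` equals
`n(n−1)/(m(m+1)(m+n)) + 1/(n+1)`. -/
theorem shapley_completeBipartiteGraph (m n : ℕ) (hm : 1 ≤ m) (hn : 1 ≤ n) (v : Fin m) :
    shapley (completeBipartiteGraph (Fin m) (Fin n)) (Sum.inl v) =
      (n : ℝ) * ((n : ℝ) - 1) / ((m : ℝ) * ((m : ℝ) + 1) * ((m : ℝ) + (n : ℝ)))
        + 1 / ((n : ℝ) + 1) := by
  obtain ⟨p, rfl⟩ : ∃ p, m = p + 1 := ⟨m - 1, by omega⟩
  have hL : ((univ.erase v).map .inl : Finset (Fin (p + 1) ⊕ Fin n)) ⊆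
      univ.erase (Sum.inl v) := by
    rintro (x | x) hx <;> simp_all
  have hR : (univ.map .inr : Finset (Fin (p + 1) ⊕ Fin n)) ⊆ univ.erase (Sum.inl v) := by
    rintro (x | x) hx <;> simp_all
  have hcard : Fintype.card (Fin (p + 1) ⊕ Fin n) = p + n + 1 := by
    simp only [Fintype.card_sum, Fintype.card_fin]
    ring
  have hsumL := sum_powerset_shapley_weight
    ((univ.erase v).map .inl : Finset (Fin (p + 1) ⊕ Fin n)) n
  have hsumR := sum_powerset_shapley_weight
    (univ.map .inr : Finset (Fin (p + 1) ⊕ Fin n)) p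
  have hsumR' := sum_powerset_shapley_weight_mul_card
    (univ.map .inr : Finset (Fin (p + 1) ⊕ Fin n)) p
  have hsumE := sum_powerset_shapley_weight (∅ : Finset (Fin (p + 1) ⊕ Fin n)) (p + n)
  simp only [card_map, card_erase_of_mem (mem_univ v), card_univ, Fintype.card_fin,
    Nat.add_sub_cancel, card_empty, Nat.zero_add, Nat.add_comm n p] at hsumL hsumR hsumR' hsumE
  rw [shapley, sum_congr rfl fun C hC => by
    rw [abs_betti_insert_sub_betti fun h => by simpa using mem_powerset.1 hC h]]
  simp only [mul_add, sum_add_distrib]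
  rw [sum_powerset_mul_ite_subset hL, sum_powerset_mul_ite_subset hR,
    sum_powerset_mul_ite_subset (empty_subset _)]
  simp only [mul_sub, sum_sub_distrib, mul_one, hcard]
  rw [hsumL, hsumR, hsumR', hsumE]
  push_cast
  have : (p : ℝ) + n + 1 ≠ 0 := by positivity
  have : (p : ℝ) + 1 + n ≠ 0 := by positivity
  have : (p : ℝ) + 1 + 1 ≠ 0 := by positivity
  field_simp
  ring
end
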